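/- arXiv:2505.15940 — 2 statements merged into one kernel-verified Lean document; each statement's English description precedes it below -/
import Mathlib

section
/- Fix ε ∈ (0, 1/3). Suppose f : ℕ → ℕ satisfies f(n) ≤ C·n^{1/3−ε} for some constant C > 0 and all n. For each n let Φₙ ~ F₂(n,n) and let Lₙ ⊆ ±[n] be an arbitrary consistent set with |Lₙ| = f(n). Then liminf_{n→∞} P((Φₙ)_{Lₙ} ∈ SAT) = liminf_{n→∞} P(Φₙ ∈ SAT), and this common value is strictly positive. -/
open Filter Topology

noncomputable section

/-- The set of literals `±[n] = {−n,…,−1,1,…,n}`. -/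
def pmSet (n : ℕ) : Finset ℤ := (Finset.Icc (-(n : ℤ)) n).filter (fun l => l ≠ 0)

/-- 2-clauses over `n` variables: pairs `(ℓ₁, ℓ₂)` of literals with `|ℓ₁| < |ℓ₂|`. -/
def clauseSet (n : ℕ) : Finset (ℤ × ℤ) :=
  ((pmSet n) ×ˢ (pmSet n)).filter (fun c => |c.1| < |c.2|)

/-- 2-CNF formulas with `n` variables and `m` clauses (ordered lists of clauses). -/
def CNF2 (n m : ℕ) : Type := Fin m → clauseSet n

instance (n m : ℕ) : Fintype (CNF2 n m) := by unfold CNF2; infer_instance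

/-- Evaluation of a literal `l ∈ ±[n]` at an assignment. -/
def litEval (x : ℕ → Bool) (l : ℤ) : Bool := if 0 < l then x l.natAbs else !(x l.natAbs)

/-- Evaluation of a 2-clause at an assignment. -/
def clauseEval (x : ℕ → Bool) (c : ℤ × ℤ) : Bool := litEval x c.1 || litEval x c.2

/-- `L ⊆ ±[n]` is consistent: `l ∈ L → -l ∉ L`. -/
def Consistent (n : ℕ) (L : Finset ℤ) : Prop := L ⊆ pmSet n ∧ ∀ l ∈ L, -l ∉ L

/-- The assignment `x_L`: coordinates indicated by `L` are fixed. -/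
def fixAssign (L : Finset ℤ) (x : ℕ → Bool) : ℕ → Bool :=
  fun v => if (v : ℤ) ∈ L then true else if -(v : ℤ) ∈ L then false else x v

/-- `φ_L ∈ SAT`: the formula `φ` with the variables indicated by `L` fixed is satisfiable. -/
def SatFixed {n m : ℕ} (L : Finset ℤ) (φ : CNF2 n m) : Prop :=
  ∃ x : ℕ → Bool, ∀ j : Fin m, clauseEval (fixAssign L x) ((φ j : ℤ × ℤ)) = true

/-- `P(Φ_L ∈ SAT)` for `Φ ~ F₂(n,m)`, i.e. uniform counting over all formulas. -/
def probSatFixed (n m : ℕ) (L : Finset ℤ) : ℝ :=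
  (Nat.card {φ : CNF2 n m // SatFixed L φ} : ℝ) / (Fintype.card (CNF2 n m) : ℝ)

/-! ### Random subsets of a finite set -/

/-- The probability that the random subset of `C` containing each element independently with
probability `q` lies in `A`. -/
def bernProb {α : Type*} (q : ℝ) (C : Finset α) (A : Set (Finset α)) : ℝ :=
  ∑ S ∈ C.powerset, q ^ S.card * (1 - q) ^ (C.card - S.card) * A.indicator 1 S

/-- Disjoint occurrence of two events. -/
def disjOcc {α : Type*} (A B : Set (Finset α)) : Set (Finset α) :=
  {S | ∃ I J, I ⊆ S ∧ J ⊆ S ∧ Disjoint I J ∧ I ∈ A ∧ J ∈ B}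

section Bernoulli

variable {α : Type*} {q : ℝ} {C : Finset α} {A B : Set (Finset α)}

lemma bernProb_mono (h0 : 0 ≤ q) (h1 : q ≤ 1) (h : ∀ S ⊆ C, S ∈ A → S ∈ B) :
    bernProb q C A ≤ bernProb q C B := by
  refine Finset.sum_le_sum fun S hS => ?_
  have : 0 ≤ 1 - q := by linarith
  refine mul_le_mul_of_nonneg_left ?_ (by positivity)
  have := h S (Finset.mem_powerset.1 hS)
  by_cases hA : S ∈ A
  · simp [hA, this hA]
  · simp only [hA, not_false_eq_true, Set.indicator_of_notMem]
    exact Set.indicator_nonneg (by simp) _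

lemma bernProb_congr (h : ∀ S ⊆ C, S ∈ A ↔ S ∈ B) : bernProb q C A = bernProb q C B := by
  classical
  refine Finset.sum_congr rfl fun S hS => ?_
  simp [Set.indicator_apply, h S (Finset.mem_powerset.1 hS)]

lemma bernProb_nonneg (h0 : 0 ≤ q) (h1 : q ≤ 1) : 0 ≤ bernProb q C A := by
  have : 0 ≤ 1 - q := by linarith
  refine Finset.sum_nonneg fun S _ => mul_nonneg (by positivity) ?_
  exact Set.indicator_nonneg (by simp) _

@[simp] lemma bernProb_empty_event : bernProb q C (∅ : Set (Finset α)) = 0 := by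
  simp [bernProb]

lemma bernProb_univ : bernProb q C Set.univ = 1 := by
  have := Finset.sum_pow_mul_eq_add_pow q (1 - q) C
  simp [bernProb, this]

lemma bernProb_union_add_inter :
    bernProb q C (A ∪ B) + bernProb q C (A ∩ B) = bernProb q C A + bernProb q C B := by
  classical
  simp only [bernProb, ← Finset.sum_add_distrib, ← mul_add]
  refine Finset.sum_congr rfl fun S _ => ?_
  congr 1
  by_cases hA : S ∈ A <;> by_cases hB : S ∈ B <;> simp [hA, hB]

lemma bernProb_compl : bernProb q C Aᶜ = 1 - bernProb q C A := by
  have h := bernProb_union_add_inter (q := q) (C := C) (A := A) (B := Aᶜ)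
  rw [Set.union_compl_self, Set.inter_compl_self, bernProb_univ, bernProb_empty_event] at h
  linarith

lemma bernProb_le_one (h0 : 0 ≤ q) (h1 : q ≤ 1) : bernProb q C A ≤ 1 :=
  (bernProb_mono h0 h1 (fun _ _ _ => trivial)).trans_eq bernProb_univ

lemma bernProb_biUnion_le {ι : Type*} (h0 : 0 ≤ q) (h1 : q ≤ 1) (s : Finset ι)
    (A : ι → Set (Finset α)) :
    bernProb q C (⋃ i ∈ s, A i) ≤ ∑ i ∈ s, bernProb q C (A i) := by
  classical
  induction s using Finset.induction_on with
  | empty => simp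
  | insert a s ha ih =>
    rw [Finset.set_biUnion_insert, Finset.sum_insert ha]
    have := bernProb_union_add_inter (q := q) (C := C) (A := A a) (B := ⋃ i ∈ s, A i)
    have h2 := bernProb_nonneg (C := C) (A := A a ∩ ⋃ i ∈ s, A i) h0 h1
    linarith

lemma bernProb_insert [DecidableEq α] {c : α} (hc : c ∉ C) :
    bernProb q (insert c C) A
      = (1 - q) * bernProb q C A + q * bernProb q C {S | insert c S ∈ A} := by
  unfold bernProb
  rw [Finset.sum_powerset_insert hc, Finset.mul_sum, Finset.mul_sum]
  congr 1
  · refine Finset.sum_congr rfl fun S hS => ?_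
    have hle := Finset.card_le_card (Finset.mem_powerset.1 hS)
    rw [Finset.card_insert_of_notMem hc, Nat.succ_sub hle, pow_succ]
    ring
  · refine Finset.sum_congr rfl fun S hS => ?_
    have hcS : c ∉ S := fun h => hc (Finset.mem_powerset.1 hS h)
    rw [Finset.card_insert_of_notMem hc, Finset.card_insert_of_notMem hcS, Nat.add_sub_add_right,
      pow_succ]
    have : A.indicator (1 : Finset α → ℝ) (insert c S)
      = Set.indicator {S | insert c S ∈ A} 1 S := rfl
    rw [this]
    ring

lemma isUpperSet_section [DecidableEq α] (hA : IsUpperSet A) (c : α) :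
    IsUpperSet {S | insert c S ∈ A} :=
  fun _ _ h hS => hA (Finset.insert_subset_insert c h) hS

lemma isLowerSet_section [DecidableEq α] (hA : IsLowerSet A) (c : α) :
    IsLowerSet {S | insert c S ∈ A} :=
  fun _ _ h hS => hA (Finset.insert_subset_insert c h) hS

/-- Harris' inequality for two decreasing events. -/
lemma mul_bernProb_le_inter (h0 : 0 ≤ q) (h1 : q ≤ 1) (hA : IsLowerSet A) (hB : IsLowerSet B) :
    bernProb q C A * bernProb q C B ≤ bernProb q C (A ∩ B) := by
  classical
  induction C using Finset.induction_on generalizing A B with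
  | empty =>
    by_cases hA : ∅ ∈ A <;> by_cases hB : ∅ ∈ B <;> simp [bernProb, hA, hB]
  | insert c C hc ih =>
    simp only [bernProb_insert hc]
    have i0 := ih hA hB
    have i1 := ih (isLowerSet_section hA c) (isLowerSet_section hB c)
    have hsec : {S | insert c S ∈ A ∩ B} = {S | insert c S ∈ A} ∩ {S | insert c S ∈ B} := rfl
    rw [hsec]
    have mA : bernProb q C {S | insert c S ∈ A} ≤ bernProb q C A :=
      bernProb_mono h0 h1 fun S _ h => hA (Finset.subset_insert c S) h
    have mB : bernProb q C {S | insert c S ∈ B} ≤ bernProb q C B :=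
      bernProb_mono h0 h1 fun S _ h => hB (Finset.subset_insert c S) h
    have k1 := mul_le_mul_of_nonneg_left i0 (sub_nonneg.2 h1)
    have k2 := mul_le_mul_of_nonneg_left i1 h0
    have k3 := mul_nonneg (mul_nonneg h0 (sub_nonneg.2 h1))
      (mul_nonneg (sub_nonneg.2 mA) (sub_nonneg.2 mB))
    nlinarith

/-- Harris' inequality for finitely many increasing events, none of which shall occur. -/
lemma prod_one_sub_le_bernProb {ι : Type*} (h0 : 0 ≤ q) (h1 : q ≤ 1) (s : Finset ι)
    {A : ι → Set (Finset α)} (hA : ∀ i, IsUpperSet (A i)) :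
    ∏ i ∈ s, (1 - bernProb q C (A i)) ≤ bernProb q C (⋃ i ∈ s, A i)ᶜ := by
  classical
  induction s using Finset.induction_on with
  | empty => simp [bernProb_univ]
  | insert a s ha ih =>
    rw [Finset.prod_insert ha, Finset.set_biUnion_insert, Set.compl_union]
    refine le_trans ?_ (mul_bernProb_le_inter h0 h1 (hA a).compl
      (isUpperSet_iUnion₂ fun i _ => hA i).compl)
    rw [bernProb_compl]
    exact mul_le_mul_of_nonneg_left ih (sub_nonneg.2 (bernProb_le_one h0 h1))

lemma exp_neg_two_mul_le {x : ℝ} (h0 : 0 ≤ x) (h1 : x ≤ 1 / 2) : Real.exp (-(2 * x)) ≤ 1 - x := by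
  have h := Real.add_one_le_exp (2 * x)
  rw [Real.exp_neg]
  refine inv_le_of_inv_le₀ (by linarith) (le_trans ?_ h)
  rw [inv_le_iff_one_le_mul₀ (by linarith)]
  nlinarith

lemma exp_le_bernProb_compl_biUnion {ι : Type*} (h0 : 0 ≤ q) (h1 : q ≤ 1) (s : Finset ι)
    {A : ι → Set (Finset α)} (hA : ∀ i, IsUpperSet (A i))
    {b : ι → ℝ} (hb : ∀ i ∈ s, bernProb q C (A i) ≤ b i) (hb' : ∀ i ∈ s, b i ≤ 1 / 2) :
    Real.exp (-(2 * ∑ i ∈ s, b i)) ≤ bernProb q C (⋃ i ∈ s, A i)ᶜ := by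
  refine le_trans ?_ (prod_one_sub_le_bernProb h0 h1 s hA)
  rw [Finset.mul_sum, ← Finset.sum_neg_distrib, Real.exp_sum]
  refine Finset.prod_le_prod (fun i _ => (Real.exp_pos _).le) fun i hi => ?_
  have := exp_neg_two_mul_le ((bernProb_nonneg h0 h1).trans (hb i hi)) (hb' i hi)
  linarith [hb i hi]

lemma isUpperSet_disjOcc : IsUpperSet (disjOcc A B) := by
  rintro S T h ⟨I, J, hI, hJ, hd⟩
  exact ⟨I, J, hI.trans h, hJ.trans h, hd⟩

lemma disjOcc_mono {A' B' : Set (Finset α)} (hA : A ⊆ A') (hB : B ⊆ B') :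
    disjOcc A B ⊆ disjOcc A' B' := by
  rintro S ⟨I, J, hI, hJ, hd, h1, h2⟩
  exact ⟨I, J, hI, hJ, hd, hA h1, hB h2⟩

/-- The van den Berg–Kesten inequality for increasing events and `q ≤ 1/2`. -/
lemma bernProb_disjOcc_le (h0 : 0 ≤ q) (h1 : q ≤ 1 / 2) (hA : IsUpperSet A) (hB : IsUpperSet B) :
    bernProb q C (disjOcc A B) ≤ bernProb q C A * bernProb q C B := by
  classical
  have h1' : q ≤ 1 := by linarith
  induction C using Finset.induction_on generalizing A B with
  | empty =>
    by_cases hA : ∅ ∈ A <;> by_cases hB : ∅ ∈ B <;>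
      simp [bernProb, hA, hB, disjOcc]
  | insert c C hc ih =>
    simp only [bernProb_insert hc]
    have hA1 := isUpperSet_section hA c
    have hB1 := isUpperSet_section hB c
    have sA : A ⊆ {S | insert c S ∈ A} := fun S h => hA (Finset.subset_insert c S) h
    have sB : B ⊆ {S | insert c S ∈ B} := fun S h => hB (Finset.subset_insert c S) h
    have i00 := ih hA hB
    have i10 := ih hA1 hB
    have i01 := ih hA hB1
    set A1 : Set (Finset α) := {S | insert c S ∈ A} with hA1def
    set B1 : Set (Finset α) := {S | insert c S ∈ B} with hB1def
    have hU : bernProb q C {S | insert c S ∈ disjOcc A B}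
        ≤ bernProb q C (disjOcc A1 B ∪ disjOcc A B1) := by
      refine bernProb_mono h0 h1' fun S _ hS => ?_
      obtain ⟨I, J, hI, hJ, hd, hIA, hJB⟩ := hS
      by_cases hcI : c ∈ I
      · have hcJ : c ∉ J := Finset.disjoint_left.1 hd hcI
        refine Or.inl ⟨I.erase c, J, Finset.subset_insert_iff.1 hI,
          (Finset.subset_insert_iff_of_notMem hcJ).1 hJ, hd.mono_left (Finset.erase_subset _ _),
          ?_, hJB⟩
        simpa [hA1def, Finset.insert_erase hcI] using hIA
      · refine Or.inr ⟨I, J.erase c, (Finset.subset_insert_iff_of_notMem hcI).1 hI,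
          Finset.subset_insert_iff.1 hJ, hd.mono_right (Finset.erase_subset _ _),
          hIA, ?_⟩
        exact hB (Finset.insert_erase_subset c J) hJB
    have hI : bernProb q C (disjOcc A B) ≤ bernProb q C (disjOcc A1 B ∩ disjOcc A B1) :=
      bernProb_mono h0 h1' fun S _ hS =>
        ⟨disjOcc_mono sA le_rfl hS, disjOcc_mono le_rfl sB hS⟩
    have hui := bernProb_union_add_inter (q := q) (C := C) (A := disjOcc A1 B) (B := disjOcc A B1)
    have mA : bernProb q C A ≤ bernProb q C A1 := bernProb_mono h0 h1' fun S _ h => sA h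
    have mB : bernProb q C B ≤ bernProb q C B1 := bernProb_mono h0 h1' fun S _ h => sB h
    have k0 := mul_le_mul_of_nonneg_left i00 (by linarith : (0 : ℝ) ≤ 1 - 2 * q)
    have k1 := mul_le_mul_of_nonneg_left i10 h0
    have k2 := mul_le_mul_of_nonneg_left i01 h0
    have k3 := mul_nonneg (mul_nonneg h0 h0) (mul_nonneg (sub_nonneg.2 mA) (sub_nonneg.2 mB))
    have k4 : q * bernProb q C {S | insert c S ∈ disjOcc A B}
        ≤ q * (bernProb q C (disjOcc A1 B) + bernProb q C (disjOcc A B1)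
          - bernProb q C (disjOcc A B)) :=
      mul_le_mul_of_nonneg_left (by linarith) h0
    nlinarith

lemma bernProb_superset {D : Finset α} (hD : D ⊆ C) :
    bernProb q C {S | D ⊆ S} = q ^ D.card := by
  classical
  induction C using Finset.induction_on generalizing D with
  | empty => simp [Finset.subset_empty.1 hD, bernProb]
  | insert c C hc ih =>
    rw [bernProb_insert hc]
    by_cases hcD : c ∈ D
    · have e0 : bernProb q C {S | D ⊆ S} = 0 := by
        rw [bernProb_congr (B := ∅), bernProb_empty_event]
        intro S hS
        simp only [Set.mem_ofPred_eq, Set.mem_empty_iff_false, iff_false]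
        exact fun h => hc (hS (h hcD))
      have e1 : {S : Finset α | insert c S ∈ {S | D ⊆ S}} = {S | D.erase c ⊆ S} := by
        ext S; simp [Finset.subset_insert_iff]
      rw [e0, e1, ih (Finset.subset_insert_iff.1 hD),
        ← Finset.card_erase_add_one hcD, pow_succ]
      ring
    · have hD' := (Finset.subset_insert_iff_of_notMem hcD).1 hD
      have e1 : {S : Finset α | insert c S ∈ {S | D ⊆ S}} = {S | D ⊆ S} := by
        ext S; simp [Finset.subset_insert_iff_of_notMem hcD]
      rw [e1, ih hD']
      ring

lemma bernProb_superset_le (h0 : 0 ≤ q) (h1 : q ≤ 1) (D : Finset α) {k : ℕ} (hk : k ≤ D.card) :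
    bernProb q C {S | D ⊆ S} ≤ q ^ k := by
  by_cases hD : D ⊆ C
  · rw [bernProb_superset hD]
    exact pow_le_pow_of_le_one h0 h1 hk
  · rw [bernProb_congr (B := ∅), bernProb_empty_event]
    · positivity
    · intro S hS
      simp only [Set.mem_ofPred_eq, Set.mem_empty_iff_false, iff_false]
      exact fun h => hD (h.trans hS)

lemma isUpperSet_superset (D : Finset α) : IsUpperSet {S : Finset α | D ⊆ S} :=
  fun _ _ h hS => hS.trans h

end Bernoulli

/-! ### Comparison with independent uniform draws -/

section Draws

variable {α : Type*} [DecidableEq α] {C : Finset α} {A B : Set (Finset α)}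

open Classical in
/-- The sequences of `m` elements of `C` whose set of values lies in `A`. -/
def drawSet (C : Finset α) (m : ℕ) (A : Set (Finset α)) : Finset (Fin m → α) :=
  {g ∈ Fintype.piFinset (fun _ : Fin m => C) | Finset.univ.image g ∈ A}

/-- The probability that the set of values of `m` independent uniform draws from `C` is in `A`. -/
def drawProb (C : Finset α) (m : ℕ) (A : Set (Finset α)) : ℝ :=
  (drawSet C m A).card / (C.card : ℝ) ^ m

lemma mem_drawSet {m : ℕ} {g : Fin m → α} :
    g ∈ drawSet C m A ↔ (∀ i, g i ∈ C) ∧ Finset.univ.image g ∈ A := by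
  simp [drawSet]

lemma drawProb_nonneg (m : ℕ) : 0 ≤ drawProb C m A := by unfold drawProb; positivity

lemma drawSet_card_le (m : ℕ) : (drawSet C m A).card ≤ C.card ^ m := by
  classical
  exact (Finset.card_le_card (Finset.filter_subset _ _)).trans_eq (by simp)

lemma drawProb_le_one (m : ℕ) : drawProb C m A ≤ 1 :=
  div_le_one_of_le₀ (by exact_mod_cast drawSet_card_le m) (by positivity)

lemma drawProb_mono (m : ℕ) (h : ∀ S ⊆ C, S ∈ A → S ∈ B) : drawProb C m A ≤ drawProb C m B := by
  unfold drawProb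
  gcongr
  intro g hg
  rw [mem_drawSet] at hg ⊢
  exact ⟨hg.1, h _ (by simpa [Finset.image_subset_iff] using hg.1) hg.2⟩

lemma drawProb_union_le (m : ℕ) : drawProb C m (A ∪ B) ≤ drawProb C m A + drawProb C m B := by
  unfold drawProb
  rw [← add_div]
  gcongr
  have : drawSet C m (A ∪ B) ⊆ drawSet C m A ∪ drawSet C m B := by
    intro g hg
    rw [Finset.mem_union, mem_drawSet, mem_drawSet]
    rw [mem_drawSet] at hg
    rcases hg.2 with h | h
    · exact Or.inl ⟨hg.1, h⟩
    · exact Or.inr ⟨hg.1, h⟩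
  exact_mod_cast (Finset.card_le_card this).trans (Finset.card_union_le _ _)

lemma monotone_drawProb (hC : C.Nonempty) (hA : IsUpperSet A) :
    Monotone (fun m => drawProb C m A) := by
  refine monotone_nat_of_le_succ fun m => ?_
  have hpos : (0 : ℝ) < C.card := by exact_mod_cast hC.card_pos
  unfold drawProb
  rw [div_le_div_iff₀ (by positivity) (by positivity), pow_succ, mul_comm ((C.card : ℝ) ^ m),
    ← mul_assoc]
  refine mul_le_mul_of_nonneg_right ?_ (by positivity)
  norm_cast
  rw [← Finset.card_product]
  refine Finset.card_le_card_of_injOn (fun p => Fin.snoc (α := fun _ => α) p.1 p.2) ?_ ?_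
  · rintro ⟨g, c⟩ h
    simp only [Finset.coe_product, Set.mem_prod, Finset.mem_coe, mem_drawSet] at h ⊢
    refine ⟨fun i => ?_, hA ?_ h.1.2⟩
    · refine Fin.lastCases ?_ (fun i => ?_) i
      · simpa using h.2
      · simpa using h.1.1 i
    · intro x hx
      obtain ⟨i, -, rfl⟩ := Finset.mem_image.1 hx
      exact Finset.mem_image.2 ⟨i.castSucc, Finset.mem_univ _, by simp⟩
  · rintro ⟨g, c⟩ - ⟨g', c'⟩ - h
    obtain ⟨h1, h2⟩ := Fin.snoc_injective2 h
    exact Prod.ext h1 h2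

lemma sum_drawSet_singleton (m : ℕ) {S : Finset α} (hS : S ⊆ C) :
    ∑ T ∈ S.powerset, (drawSet C m {T}).card = S.card ^ m := by
  have h : (Fintype.piFinset (fun _ : Fin m => S)).card = S.card ^ m := by simp
  rw [← h, Finset.card_eq_sum_card_fiberwise (f := fun g => Finset.univ.image g)
    (t := S.powerset)]
  · refine Finset.sum_congr rfl fun T hT => ?_
    congr 1
    ext g
    simp only [mem_drawSet, Set.mem_singleton_iff, Finset.mem_filter, Fintype.mem_piFinset]
    refine and_congr_left fun hg => ⟨fun _ i => ?_, fun h i => hS (h i)⟩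
    refine Finset.mem_powerset.1 hT ?_
    rw [← hg]
    exact Finset.mem_image_of_mem _ (Finset.mem_univ i)
  · intro g hg
    simp only [Finset.mem_coe, Fintype.mem_piFinset, Finset.mem_powerset] at hg ⊢
    intro x hx
    obtain ⟨i, -, rfl⟩ := Finset.mem_image.1 hx
    exact hg i

lemma hasSum_pow_div_factorial (x : ℝ) :
    HasSum (fun m : ℕ => x ^ m / (m.factorial : ℝ)) (Real.exp x) := by
  have := NormedSpace.expSeries_div_hasSum_exp x
  rwa [← Real.exp_eq_exp_ℝ] at this

lemma hasSum_drawSet_singleton (a : ℝ) {S : Finset α} (hS : S ⊆ C) :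
    HasSum (fun m : ℕ => a ^ m / (m.factorial : ℝ) * (drawSet C m {S}).card)
      ((Real.exp a - 1) ^ S.card) := by
  induction S using Finset.strongInduction with
  | H S ih =>
    have h1 := hasSum_pow_div_factorial (a * S.card)
    have h2 : HasSum (fun m : ℕ => ∑ T ∈ S.ssubsets,
        a ^ m / (m.factorial : ℝ) * (drawSet C m {T}).card)
        (∑ T ∈ S.ssubsets, (Real.exp a - 1) ^ T.card) :=
      hasSum_sum fun T hT => ih T (Finset.mem_ssubsets.1 hT)
        ((Finset.mem_ssubsets.1 hT).subset.trans hS)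
    have hS' : S ∈ S.powerset := Finset.mem_powerset_self S
    have e1 : (fun m : ℕ => a ^ m / (m.factorial : ℝ) * (drawSet C m {S}).card)
        = fun m => (a * S.card) ^ m / (m.factorial : ℝ) - ∑ T ∈ S.ssubsets,
          a ^ m / (m.factorial : ℝ) * (drawSet C m {T}).card := by
      ext m
      have := sum_drawSet_singleton m hS
      rw [← Finset.add_sum_erase _ _ hS'] at this
      rw [← Finset.mul_sum, mul_pow, Finset.ssubsets]
      have h3 : ((drawSet C m {S}).card : ℝ)
          + ∑ T ∈ S.powerset.erase S, ((drawSet C m {T}).card : ℝ) = (S.card : ℝ) ^ m := by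
        exact_mod_cast this
      rw [← h3]
      ring
    have e2 : (Real.exp a - 1) ^ S.card
        = Real.exp (a * S.card) - ∑ T ∈ S.ssubsets, (Real.exp a - 1) ^ T.card := by
      have h4 := Finset.sum_pow_mul_eq_add_pow (Real.exp a - 1) 1 S
      rw [← Finset.add_sum_erase _ _ hS'] at h4
      simp only [one_pow, mul_one, sub_add_cancel] at h4
      rw [Finset.ssubsets, mul_comm a, Real.exp_nat_mul, ← h4]
      ring
    rw [e1, e2]
    exact h1.sub h2

lemma hasSum_poisson_drawProb (hC : C.Nonempty) (a : ℝ) :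
    HasSum (fun m : ℕ => Real.exp (-a) * (a ^ m / (m.factorial : ℝ)) * drawProb C m A)
      (bernProb (1 - Real.exp (-(a / C.card))) C A) := by
  have hpos : (0 : ℝ) < C.card := by exact_mod_cast hC.card_pos
  obtain ⟨b, rfl⟩ : ∃ b, a = b * C.card := ⟨a / C.card, by field_simp⟩
  rw [mul_div_cancel_right₀ b hpos.ne']
  generalize ha : b * C.card = a
  have hsum : HasSum (fun m : ℕ => ∑ S ∈ C.powerset,
      (Real.exp (-a) * A.indicator 1 S) * (b ^ m / (m.factorial : ℝ) * (drawSet C m {S}).card))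
      (∑ S ∈ C.powerset, (Real.exp (-a) * A.indicator 1 S) * (Real.exp b - 1) ^ S.card) :=
    hasSum_sum fun S hS => (hasSum_drawSet_singleton b (Finset.mem_powerset.1 hS)).mul_left _
  convert hsum using 1
  · ext m
    have hcard : ((drawSet C m A).card : ℝ)
        = ∑ S ∈ C.powerset, A.indicator 1 S * ((drawSet C m {S}).card : ℝ) := by
      rw [Finset.card_eq_sum_card_fiberwise (f := fun g => Finset.univ.image g)
        (t := C.powerset)]
      · push_cast
        refine Finset.sum_congr rfl fun S _ => ?_
        by_cases hSA : S ∈ A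
        · rw [Set.indicator_of_mem hSA, Pi.one_apply, one_mul]
          congr 2
          ext g
          simp only [mem_drawSet, Finset.mem_filter, Set.mem_singleton_iff]
          exact ⟨fun h => ⟨h.1.1, h.2⟩, fun h => ⟨⟨h.1, h.2 ▸ hSA⟩, h.2⟩⟩
        · rw [Set.indicator_of_notMem hSA, zero_mul, Nat.cast_eq_zero, Finset.card_eq_zero]
          refine Finset.filter_eq_empty_iff.2 fun g hg hgS => hSA ?_
          exact hgS ▸ (mem_drawSet.1 hg).2
      · intro g hg
        have := (mem_drawSet.1 hg).1
        simp only [Finset.mem_coe, Finset.mem_powerset]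
        intro x hx
        obtain ⟨i, -, rfl⟩ := Finset.mem_image.1 hx
        exact this i
    rw [drawProb, hcard, ← ha, mul_pow, Finset.sum_div, Finset.mul_sum]
    refine Finset.sum_congr rfl fun S _ => ?_
    field_simp
  · refine Finset.sum_congr rfl fun S hS => ?_
    have hle := Finset.card_le_card (Finset.mem_powerset.1 hS)
    have e1 : Real.exp (-a) = Real.exp (-b) ^ S.card * Real.exp (-b) ^ (C.card - S.card) := by
      rw [← pow_add, Nat.add_sub_cancel' hle, ← Real.exp_nat_mul, ← ha]
      ring_nf
    have e2 : Real.exp (-b) * (Real.exp b - 1) = 1 - Real.exp (-b) := by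
      rw [mul_sub, ← Real.exp_add, neg_add_cancel, Real.exp_zero, mul_one]
    rw [e1, sub_sub_cancel, ← e2, mul_pow]
    ring

/-- De-Poissonization with a Chernoff error term. -/
lemma drawProb_le_bernProb_add (hC : C.Nonempty) (hA : IsUpperSet A) {a θ : ℝ} (ha : 0 ≤ a)
    (h0 : 0 < θ) (h1 : θ ≤ 1) (n : ℕ) :
    drawProb C n A ≤ bernProb (1 - Real.exp (-(a / C.card))) C A
      + (θ ^ n)⁻¹ * Real.exp (a * θ - a) := by
  have s1 := hasSum_poisson_drawProb (A := A) hC a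
  have s2 := (hasSum_pow_div_factorial (a * θ)).mul_left ((θ ^ n)⁻¹ * Real.exp (-a))
  have s3 := (hasSum_pow_div_factorial a).mul_left (Real.exp (-a) * drawProb C n A)
  have key := hasSum_le (fun m => ?_) s3 (s1.add s2)
  · have e : Real.exp (-a) * Real.exp a = 1 := by rw [← Real.exp_add]; simp
    have e' : Real.exp (a * θ - a) = Real.exp (-a) * Real.exp (a * θ) := by
      rw [← Real.exp_add]; ring_nf
    rw [e', ← mul_assoc]
    calc drawProb C n A = Real.exp (-a) * drawProb C n A * Real.exp a := by
          rw [mul_right_comm, e, one_mul]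
      _ ≤ _ := key
  · have hd : drawProb C n A ≤ drawProb C m A + (θ ^ n)⁻¹ * θ ^ m := by
      rcases le_total n m with h | h
      · have := monotone_drawProb hC hA h
        simp only at this
        have : 0 ≤ (θ ^ n)⁻¹ * θ ^ m := by positivity
        linarith
      · have h2 := drawProb_le_one (C := C) (A := A) n
        have h3 := drawProb_nonneg (C := C) (A := A) m
        have h4 : 1 ≤ (θ ^ n)⁻¹ * θ ^ m := by
          rw [inv_mul_eq_div, one_le_div (by positivity)]
          exact pow_le_pow_of_le_one h0.le h1 h
        linarith
    have hw : 0 ≤ Real.exp (-a) * (a ^ m / (m.factorial : ℝ)) := by positivity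
    have := mul_le_mul_of_nonneg_left hd hw
    rw [mul_pow]
    calc _ = Real.exp (-a) * (a ^ m / (m.factorial : ℝ)) * drawProb C n A := by ring
      _ ≤ _ := this
      _ = _ := by ring

end Draws

/-! ### The implication digraph of a 2-CNF formula -/

/-- The clause expressing the implication `u → v`. -/
def implClause (u v : ℤ) : ℤ × ℤ := if |u| < |v| then (-u, v) else (v, -u)

/-- `w 0 → w 1 → ⋯ → w k` is a walk in the implication digraph of `S`. -/
def IsWalk (S : Finset (ℤ × ℤ)) (w : ℕ → ℤ) (k : ℕ) : Prop :=
  ∀ i < k, implClause (w i) (w (i + 1)) ∈ S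

/-- The first `k` literals of `w` belong to distinct variables. -/
def DistinctVars (w : ℕ → ℤ) (k : ℕ) : Prop :=
  ∀ i < k, ∀ j < k, |w i| = |w j| → i = j

/-- The clause sets that are unsatisfiable once the literals of `L` are fixed. -/
def unsatFixed (L : Finset ℤ) : Set (Finset (ℤ × ℤ)) :=
  {S | ¬ ∃ x : ℕ → Bool, ∀ c ∈ S, clauseEval (fixAssign L x) c = true}

/-- There is a path of the implication digraph ending with a literal whose negation is on the
path or in `X`. -/
def Lasso (S : Finset (ℤ × ℤ)) (X : Set ℤ) (w : ℕ → ℤ) (t : ℕ) : Prop :=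
  IsWalk S w (t + 1) ∧ DistinctVars w (t + 1) ∧ (-w (t + 1) ∈ X ∨ ∃ j ≤ t, -w (t + 1) = w j)

section Deterministic

variable {n : ℕ} {S : Finset (ℤ × ℤ)} {u v : ℤ}

lemma fixAssign_empty (x : ℕ → Bool) : fixAssign ∅ x = x := by
  funext k
  simp [fixAssign]

lemma mem_pmSet : u ∈ pmSet n ↔ |u| ≤ n ∧ u ≠ 0 := by
  simp [pmSet, abs_le]

lemma neg_mem_pmSet : -u ∈ pmSet n ↔ u ∈ pmSet n := by simp [mem_pmSet]

lemma mem_clauseSet {c : ℤ × ℤ} :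
    c ∈ clauseSet n ↔ c.1 ∈ pmSet n ∧ c.2 ∈ pmSet n ∧ |c.1| < |c.2| := by
  simp [clauseSet, and_assoc]

lemma implClause_mem_clauseSet (h : implClause u v ∈ clauseSet n) :
    u ∈ pmSet n ∧ v ∈ pmSet n ∧ |u| ≠ |v| := by
  unfold implClause at h
  split_ifs at h with huv
  · simp only [mem_clauseSet, neg_mem_pmSet] at h
    exact ⟨h.1, h.2.1, huv.ne⟩
  · simp only [mem_clauseSet, neg_mem_pmSet, abs_neg] at h
    exact ⟨h.2.1, h.1, h.2.2.ne'⟩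

lemma implClause_neg (h : |u| ≠ |v|) : implClause (-v) (-u) = implClause u v := by
  unfold implClause
  rcases lt_or_gt_of_ne h with h | h <;> simp [h, not_lt_of_gt]

lemma implClause_inj {u' v' : ℤ} (h : implClause u v = implClause u' v') :
    (u = u' ∧ v = v') ∨ (u = -v' ∧ v = -u') := by
  unfold implClause at h
  split_ifs at h <;> simp only [Prod.mk.injEq] at h <;> omega

lemma implClause_neg_fst {c : ℤ × ℤ} (hc : c ∈ clauseSet n) : implClause (-c.1) c.2 = c := by
  have := (mem_clauseSet.1 hc).2.2
  simp [implClause, this]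

lemma implClause_neg_snd {c : ℤ × ℤ} (hc : c ∈ clauseSet n) : implClause (-c.2) c.1 = c := by
  have := (mem_clauseSet.1 hc).2.2
  simp [implClause, this.le]

lemma implClause_neg_mem (hS : S ⊆ clauseSet n) (h : implClause u v ∈ S) :
    implClause (-v) (-u) ∈ S := by
  rwa [implClause_neg (implClause_mem_clauseSet (hS h)).2.2]

/-- Reachability in the implication digraph. -/
def Reach (S : Finset (ℤ × ℤ)) : ℤ → ℤ → Prop :=
  Relation.ReflTransGen fun u v => implClause u v ∈ S

lemma Reach.neg (hS : S ⊆ clauseSet n) (h : Reach S u v) : Reach S (-v) (-u) := by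
  induction h with
  | refl => exact Relation.ReflTransGen.refl
  | tail _ hbc ih => exact Relation.ReflTransGen.head (implClause_neg_mem hS hbc) ih

lemma litEval_override {R : Set ℤ} [DecidablePred (· ∈ R)] (hcons : ∀ u ∈ R, -u ∉ R)
    (y : ℕ → Bool) (hu : u ≠ 0) :
    litEval (fun k => if (k : ℤ) ∈ R then true else if -(k : ℤ) ∈ R then false else y k) u
      = if u ∈ R then true else if -u ∈ R then false else litEval y u := by
  unfold litEval
  rcases lt_or_gt_of_ne hu with h | h
  · have e : ((u.natAbs : ℕ) : ℤ) = -u := by omega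
    have := hcons u
    simp only [not_lt.2 h.le, if_false, e, neg_neg]
    by_cases h1 : u ∈ R <;> by_cases h2 : -u ∈ R <;> simp_all
  · have e : ((u.natAbs : ℕ) : ℤ) = u := by omega
    simp only [h, if_true, e]

lemma notMem_unsatFixed_of_closed (hS : S ⊆ clauseSet n) {L : Finset ℤ} {R : Set ℤ}
    (hL : ∀ u ∈ L, u ∈ R) (hcons : ∀ u ∈ R, -u ∉ R)
    (hclosed : ∀ u v, u ∈ R → implClause u v ∈ S → v ∈ R) (y : ℕ → Bool)
    (hy : ∀ c ∈ S, c.1 ∉ R → -c.1 ∉ R → c.2 ∉ R → -c.2 ∉ R → clauseEval y c = true) :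
    S ∉ unsatFixed L := by
  classical
  simp only [unsatFixed, Set.mem_ofPred_eq, not_not]
  set x : ℕ → Bool :=
    fun k => if (k : ℤ) ∈ R then true else if -(k : ℤ) ∈ R then false else y k with hx
  refine ⟨x, fun c hc => ?_⟩
  have hfix : fixAssign L x = x := by
    funext k
    unfold fixAssign
    split_ifs with h1 h2
    · simp [hx, hL _ h1]
    · have h3 := hL _ h2
      have h4 : (k : ℤ) ∉ R := fun h => hcons _ h h3
      simp [hx, h3, h4]
    · rfl
  obtain ⟨h1, h2, -⟩ := mem_clauseSet.1 (hS hc)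
  have e1 := hclosed (-c.1) c.2
  have e2 := hclosed (-c.2) c.1
  rw [implClause_neg_fst (hS hc)] at e1
  rw [implClause_neg_snd (hS hc)] at e2
  have hyc := hy c hc
  rw [hfix, clauseEval, litEval_override hcons y (mem_pmSet.1 h1).2,
    litEval_override hcons y (mem_pmSet.1 h2).2]
  rw [clauseEval] at hyc
  have := hcons c.1
  have := hcons c.2
  by_cases a1 : c.1 ∈ R <;> by_cases a2 : c.2 ∈ R <;> by_cases a3 : -c.1 ∈ R <;>
    by_cases a4 : -c.2 ∈ R <;> simp_all

lemma exists_contradictory_of_unsat (hS : S ⊆ clauseSet n) (h : S ∈ unsatFixed ∅) :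
    ∃ x, x ∈ pmSet n ∧ Reach S x (-x) ∧ Reach S (-x) x := by
  classical
  by_contra! hno
  let F : Finset (Finset ℤ) := {R ∈ (pmSet n).powerset |
    (∀ u ∈ R, -u ∉ R) ∧ ∀ u v, u ∈ R → implClause u v ∈ S → v ∈ R}
  have hF : F.Nonempty := ⟨∅, by simp [F]⟩
  obtain ⟨R, hR, hmax⟩ := F.exists_max_image Finset.card hF
  simp only [F, Finset.mem_filter, Finset.mem_powerset] at hR hmax
  obtain ⟨hRpm, hRc, hRcl⟩ := hR
  have hreach : ∀ u v, u ∈ R → Reach S u v → v ∈ R := by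
    intro u v hu huv
    induction huv with
    | refl => exact hu
    | tail _ hbc ih => exact hRcl _ _ ih hbc
  have hgrow : ∀ x ∈ pmSet n, x ∉ R → -x ∉ R → ¬ Reach S x (-x) → False := by
    intro x hx hxR hxR' hxx
    have hle := hmax (R ∪ {v ∈ pmSet n | Reach S x v}) ⟨?_, ?_, ?_⟩
    · have : (R ∪ {v ∈ pmSet n | Reach S x v}) = R :=
        (Finset.eq_of_subset_of_card_le Finset.subset_union_left hle).symm
      refine hxR (this ▸ Finset.mem_union_right _ ?_)
      exact Finset.mem_filter.2 ⟨hx, Relation.ReflTransGen.refl⟩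
    · exact Finset.union_subset hRpm (Finset.filter_subset _ _)
    · intro u hu hu'
      simp only [Finset.mem_union, Finset.mem_filter] at hu hu'
      rcases hu with hu | hu <;> rcases hu' with hu' | hu'
      · exact hRc u hu hu'
      · exact hxR' (hreach u _ hu (by simpa using hu'.2.neg hS))
      · exact hxR' (hreach (-u) _ hu' (hu.2.neg hS))
      · exact hxx (Relation.ReflTransGen.trans hu.2
          (show Reach S u (-x) by simpa using hu'.2.neg hS))
    · intro u v hu huv
      simp only [Finset.mem_union, Finset.mem_filter] at hu ⊢
      rcases hu with hu | hu
      · exact Or.inl (hRcl u v hu huv)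
      · exact Or.inr ⟨(implClause_mem_clauseSet (hS huv)).2.1, hu.2.tail huv⟩
  have hcomplete : ∀ x ∈ pmSet n, x ∉ R → -x ∈ R := by
    intro x hx hxR
    by_contra hxR'
    refine hgrow x hx hxR hxR' fun hr => ?_
    refine hgrow (-x) (neg_mem_pmSet.2 hx) hxR' (by simpa using hxR) ?_
    simpa using hno x hx hr
  refine notMem_unsatFixed_of_closed (R := (R : Set ℤ)) hS (by simp) (by simpa using hRc)
    (by simpa using hRcl) (fun _ => true) ?_ h
  intro c hc h1 h2
  exact absurd (hcomplete _ (mem_clauseSet.1 (hS hc)).1 h1) h2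

lemma exists_reach_of_unsatFixed (hS : S ⊆ clauseSet n) {L : Finset ℤ}
    (hsat : S ∉ unsatFixed ∅) (h : S ∈ unsatFixed L) :
    ∃ a ∈ L, ∃ b ∈ L, Reach S a (-b) := by
  classical
  by_contra! hno
  simp only [unsatFixed, Set.mem_ofPred_eq, not_not] at hsat
  obtain ⟨y, hy⟩ := hsat
  rw [fixAssign_empty] at hy
  refine notMem_unsatFixed_of_closed (R := {v | ∃ a ∈ L, Reach S a v}) hS
    (fun u hu => ⟨u, hu, Relation.ReflTransGen.refl⟩) ?_ ?_ y (fun c hc _ _ _ _ => hy c hc) h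
  · rintro u ⟨a, ha, hau⟩ ⟨b, hb, hbu⟩
    exact hno a ha b hb (hau.trans (show Reach S u (-b) by simpa using hbu.neg hS))
  · rintro u v ⟨a, ha, hau⟩ huv
    exact ⟨a, ha, hau.tail huv⟩

lemma Reach.exists_walk (h : Reach S u v) : ∃ w k, w 0 = u ∧ w k = v ∧ IsWalk S w k := by
  induction h with
  | refl => exact ⟨fun _ => u, 0, rfl, rfl, fun i hi => absurd hi (by omega)⟩
  | @tail b c _ hbc ih =>
    obtain ⟨w, k, h0, hk, hw⟩ := ih
    refine ⟨fun i => if i ≤ k then w i else c, k + 1, by simpa using h0, by simp, ?_⟩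
    intro i hi
    rcases Nat.lt_succ_iff_lt_or_eq.1 hi with h | h
    · simpa [h.le, Nat.succ_le_of_lt h] using hw i h
    · subst h
      simpa [hk] using hbc

lemma exists_lasso {X : Set ℤ} {a b : ℤ} (ha : -a ∉ X) (hb : b ∈ X) (h : Reach S a (-b)) :
    ∃ w t, w 0 = a ∧ Lasso S X w t := by
  classical
  have hex : ∃ k, ∃ w : ℕ → ℤ, w 0 = a ∧ -w k ∈ X ∧ IsWalk S w k := by
    obtain ⟨w, k, h0, hk, hw⟩ := h.exists_walk
    exact ⟨k, w, h0, by simpa [hk] using hb, hw⟩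
  obtain ⟨w, h0, hk, hw⟩ := Nat.find_spec hex
  set k := Nat.find hex with hkdef
  have hinj : ∀ i j, i < j → j ≤ k → w i ≠ w j := by
    intro i j hij hjk heq
    refine Nat.find_min hex (m := k - (j - i)) (by omega)
      ⟨fun m => if m ≤ i then w m else w (m + (j - i)), by simpa using h0, ?_, ?_⟩
    · by_cases hkj : k - (j - i) ≤ i
      · have e1 : k - (j - i) = i := by omega
        have e2 : j = k := by omega
        show -(if k - (j - i) ≤ i then _ else _) ∈ X
        rw [if_pos hkj, e1, heq, e2]
        exact hk
      · simp only [hkj, if_false]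
        rwa [show k - (j - i) + (j - i) = k by omega]
    · intro m hm
      rcases lt_trichotomy m i with h | h | h
      · simpa [h.le, Nat.succ_le_of_lt h] using hw m (by omega)
      · subst h
        have := hw j (by omega)
        simp only [le_refl, if_true, show ¬ m + 1 ≤ m by omega, if_false, heq]
        rwa [show m + 1 + (j - m) = j + 1 by omega]
      · have := hw (m + (j - i)) (by omega)
        simp only [show ¬ m ≤ i by omega, show ¬ m + 1 ≤ i by omega, if_false]
        rwa [show m + 1 + (j - i) = m + (j - i) + 1 by omega]
  have hex2 : ∃ m, -w m ∈ X ∨ ∃ j < m, -w m = w j := ⟨k, Or.inl hk⟩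
  have hspec := Nat.find_spec hex2
  have hle : Nat.find hex2 ≤ k := Nat.find_min' hex2 (Or.inl hk)
  have hmin : ∀ m < Nat.find hex2, ¬ (-w m ∈ X ∨ ∃ j < m, -w m = w j) :=
    fun m hm => Nat.find_min hex2 hm
  obtain ⟨t, ht⟩ : ∃ t, Nat.find hex2 = t + 1 := by
    refine Nat.exists_eq_succ_of_ne_zero fun hz => ?_
    rw [hz] at hspec
    rcases hspec with h | ⟨j, hj, -⟩
    · exact ha (h0 ▸ h)
    · omega
  rw [ht] at hspec hle hmin
  refine ⟨w, t, h0, fun i hi => hw i (by omega), ?_, ?_⟩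
  · have aux : ∀ i j, i < j → j < t + 1 → |w i| ≠ |w j| := by
      intro i j hij hj he
      rcases abs_eq_abs.1 he with h | h
      · exact hinj i j hij (by omega) h
      · exact hmin j hj (Or.inr ⟨i, hij, h.symm⟩)
    intro i hi j hj he
    rcases lt_trichotomy i j with h | h | h
    · exact absurd he (aux i j h hj)
    · exact h
    · exact absurd he.symm (aux j i h hi)
  · rcases hspec with h | ⟨j, hj, h⟩
    · exact Or.inl h
    · exact Or.inr ⟨j, by omega, h⟩

end Deterministic

/-- A walk through distinct variables that can be entered from, and left to, one of its own
variables. -/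
def Bicycle (S : Finset (ℤ × ℤ)) (W : ℕ → ℤ) (k : ℕ) : Prop :=
  IsWalk S W k ∧ DistinctVars W (k + 1) ∧
    (∃ u, ∃ i ≤ k, |u| = |W i| ∧ implClause u (W 0) ∈ S) ∧
    ∃ j ≤ k, implClause (W k) (-W j) ∈ S

section Bicycles

variable {n : ℕ} {S : Finset (ℤ × ℤ)} {u v : ℤ}

lemma DistinctVars.of_lt {w : ℕ → ℤ} {k : ℕ} (h : ∀ i j, i < j → j < k → |w i| ≠ |w j|) :
    DistinctVars w k := by
  intro i hi j hj he
  rcases lt_trichotomy i j with hij | hij | hij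
  · exact absurd he (h i j hij hj)
  · exact hij
  · exact absurd he.symm (h j i hij hi)

lemma exists_bicycle_of_unsat (hS : S ⊆ clauseSet n) (h : S ∈ unsatFixed ∅) :
    ∃ W k, Bicycle S W k := by
  classical
  obtain ⟨x, hx, h1, h2⟩ := exists_contradictory_of_unsat hS h
  have hx0 := (mem_pmSet.1 hx).2
  obtain ⟨w, t, hw0, hw, hwd, hwe⟩ := exists_lasso (X := {x}) (a := x) (b := x)
    (by simp only [Set.mem_singleton_iff]; omega) rfl h1
  have hwe' : ∃ j ≤ t, -w (t + 1) = w j := by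
    rcases hwe with h | h
    · exact ⟨0, by omega, by rw [hw0]; exact h⟩
    · exact h
  obtain ⟨j, hj, hwj⟩ := hwe'
  obtain ⟨w', k, hw'0, hw'k, hw'⟩ := h2.exists_walk
  have hk0 : 0 < k := Nat.pos_of_ne_zero fun hk => by
    rw [hk, hw'0] at hw'k
    omega
  set z : ℕ → ℤ := fun i => -w' i with hz
  have hz0 : z 0 = x := by simp [hz, hw'0]
  have hzk : z k = -x := by simp [hz, hw'k]
  have hzw : ∀ i < k, implClause (z (i + 1)) (z i) ∈ S :=
    fun i hi => implClause_neg_mem hS (hw' i hi)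
  have hex : ∃ m, 0 < m ∧ ((∃ i < m, |z m| = |z i|) ∨ ∃ i ≤ t, |z m| = |w i|) := by
    exact ⟨k, hk0, Or.inr ⟨0, by omega, by simp [hzk, hw0]⟩⟩
  obtain ⟨hpos, hspec⟩ := Nat.find_spec hex
  have hle : Nat.find hex ≤ k :=
    Nat.find_min' hex ⟨hk0, Or.inr ⟨0, by omega, by simp [hzk, hw0]⟩⟩
  have hmin : ∀ m < Nat.find hex, 0 < m →
      (∀ i < m, |z m| ≠ |z i|) ∧ ∀ i ≤ t, |z m| ≠ |w i| := by
    intro m hm hm0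
    have := Nat.find_min hex hm
    refine ⟨fun i hi he => this ⟨hm0, Or.inl ⟨i, hi, he⟩⟩,
      fun i hi he => this ⟨hm0, Or.inr ⟨i, hi, he⟩⟩⟩
  obtain ⟨s, hs⟩ := Nat.exists_eq_succ_of_ne_zero hpos.ne'
  rw [hs] at hspec hle hmin
  simp only [Nat.succ_eq_add_one] at hspec hle hmin
  set W : ℕ → ℤ := fun i => if i ≤ s then z (s - i) else w (i - s) with hW
  have hWz : ∀ i ≤ s, W i = z (s - i) := fun i hi => by simp [hW, hi]
  have hWw : ∀ i, W (s + i) = w i := by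
    intro i
    rcases Nat.eq_zero_or_pos i with rfl | hi
    · simp [hW, hz0, hw0]
    · simp [hW, show ¬ s + i ≤ s by omega]
  refine ⟨W, s + t, ?_, DistinctVars.of_lt ?_, ⟨z (s + 1), ?_⟩, j + s, by omega, ?_⟩
  · intro i hi
    by_cases his : i < s
    · rw [hWz i his.le, hWz (i + 1) his]
      have := hzw (s - (i + 1)) (by omega)
      rwa [show s - (i + 1) + 1 = s - i by omega] at this
    · obtain ⟨i, rfl⟩ := Nat.exists_eq_add_of_le (not_lt.1 his)
      rw [add_assoc, hWw, hWw]
      exact hw i (by omega)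
  · intro a b hab hb
    by_cases hbs : b ≤ s
    · rw [hWz a (by omega), hWz b hbs]
      exact (hmin (s - a) (by omega) (by omega)).1 _ (by omega)
    · obtain ⟨b, rfl⟩ := Nat.exists_eq_add_of_le (not_le.1 hbs).le
      rw [hWw]
      by_cases has : a < s
      · rw [hWz a has.le]
        exact (hmin (s - a) (by omega) (by omega)).2 _ (by omega)
      · obtain ⟨a, rfl⟩ := Nat.exists_eq_add_of_le (not_lt.1 has)
        rw [hWw]
        intro he
        have := hwd a (by omega) b (by omega) he
        omega
  · have hmem : implClause (z (s + 1)) (W 0) ∈ S := by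
      rw [hWz 0 (by omega)]
      exact hzw s (by omega)
    rcases hspec with ⟨i, hi, he⟩ | ⟨i, hi, he⟩
    · exact ⟨s - i, by omega, by rw [hWz _ (by omega), he, show s - (s - i) = i by omega], hmem⟩
    · exact ⟨s + i, by omega, by rw [hWw, he], hmem⟩
  · rw [hWw, add_comm, hWw, ← hwj, neg_neg]
    exact hw t (by omega)

lemma IsWalk.mem_pmSet {w : ℕ → ℤ} {k : ℕ} (hS : S ⊆ clauseSet n) (h : IsWalk S w k)
    (h0 : w 0 ∈ pmSet n) : ∀ i ≤ k, w i ∈ pmSet n := by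
  intro i hi
  rcases i with _ | i
  · exact h0
  · exact (implClause_mem_clauseSet (hS (h i hi))).2.1

lemma DistinctVars.le {w : ℕ → ℤ} {k : ℕ} (h : DistinctVars w k)
    (hw : ∀ i < k, w i ∈ pmSet n) : k ≤ n := by
  have := Finset.card_le_card_of_injOn (s := Finset.range k) (t := Finset.Icc 1 n)
    (fun i => (w i).natAbs) ?_ ?_
  · simpa using this
  · intro i hi
    have h1 := mem_pmSet.1 (hw i (by simpa using hi))
    rw [Int.abs_eq_natAbs] at h1
    simp only [Finset.coe_Icc, Set.mem_Icc]
    omega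
  · intro i hi j hj he
    refine h i (by simpa using hi) j (by simpa using hj) ?_
    rw [Int.abs_eq_natAbs, Int.abs_eq_natAbs]
    exact_mod_cast he

lemma Bicycle.zero_mem {W : ℕ → ℤ} {k : ℕ} (hS : S ⊆ clauseSet n) (h : Bicycle S W k) :
    W 0 ∈ pmSet n := by
  obtain ⟨-, -, ⟨u, i, -, -, hu⟩, -⟩ := h
  exact (implClause_mem_clauseSet (hS hu)).2.1

end Bicycles

/-- The literal `a` starts a path of `k` implications through distinct variables outside `U`. -/
def survive (n : ℕ) : ℕ → Finset ℕ → ℤ → Set (Finset (ℤ × ℤ))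
  | 0, _, _ => Set.univ
  | k + 1, U, a => {S | ∃ b ∈ pmSet n, b.natAbs ∉ insert a.natAbs U ∧ implClause a b ∈ S ∧
      S ∈ survive n k (insert a.natAbs U) b}

section Survival

variable {n : ℕ} {S : Finset (ℤ × ℤ)} {q : ℝ}

lemma isUpperSet_survive (n k : ℕ) (U : Finset ℕ) (a : ℤ) : IsUpperSet (survive n k U a) := by
  induction k generalizing U a with
  | zero => exact isUpperSet_univ
  | succ k ih =>
    rintro S T hST ⟨b, hb, hbU, hab, h⟩
    exact ⟨b, hb, hbU, hST hab, ih _ _ hST h⟩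

lemma filter_mem_survive {k : ℕ} {U : Finset ℕ} {a : ℤ} (ha : a.natAbs ∉ U)
    (h : S ∈ survive n k U a) :
    {c ∈ S | c.1.natAbs ∉ U ∧ c.2.natAbs ∉ U} ∈ survive n k U a := by
  induction k generalizing U a with
  | zero => trivial
  | succ k ih =>
    obtain ⟨b, hb, hbU, hab, h⟩ := h
    refine ⟨b, hb, hbU, ?_, isUpperSet_survive _ _ _ _ ?_ (ih hbU h)⟩
    · have hb' : b.natAbs ∉ U := fun h => hbU (Finset.mem_insert_of_mem h)
      rw [Finset.mem_filter]
      refine ⟨hab, ?_⟩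
      unfold implClause
      split_ifs <;> simp [ha, hb']
    · intro c hc
      simp only [Finset.mem_filter, Finset.mem_insert, not_or] at hc ⊢
      exact ⟨hc.1, hc.2.1.2, hc.2.2.2⟩

lemma card_pmSet (n : ℕ) : (pmSet n).card = 2 * n := by
  have : pmSet n = (Finset.Icc (-(n : ℤ)) n).erase 0 := by
    ext l; simp [pmSet, and_comm]
  rw [this, Finset.card_erase_of_mem (by simp), Int.card_Icc]
  omega

lemma bernProb_survive_succ_le (h0 : 0 ≤ q) (h1 : q ≤ 1 / 2) {C : Finset (ℤ × ℤ)} {k : ℕ} {s : ℝ}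
    (hs1 : s ≤ 1)
    (h : ∀ U a, bernProb q C (survive n k U a) ≤ s) (U : Finset ℕ) (a : ℤ) :
    bernProb q C (survive n (k + 1) U a) ≤ 1 - (1 - q * s) ^ (2 * n) := by
  classical
  have h1' : q ≤ 1 := by linarith
  set E : ℤ → Set (Finset (ℤ × ℤ)) := fun b => {S | b.natAbs ∉ insert a.natAbs U ∧
    implClause a b ∈ S ∧ S ∈ survive n k (insert a.natAbs U) b} with hE
  have hup : ∀ b, IsUpperSet (E b) := by
    rintro b S T hST ⟨hbU, hab, h⟩
    exact ⟨hbU, hST hab, isUpperSet_survive _ _ _ _ hST h⟩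
  have hs : 0 ≤ s := (bernProb_nonneg h0 h1').trans (h ∅ 0)
  have hprob : ∀ b, bernProb q C (E b) ≤ q * s := by
    intro b
    have hsub : E b ⊆ disjOcc {S | {implClause a b} ⊆ S} (survive n k (insert a.natAbs U) b) := by
      rintro S ⟨hbU, hab, h⟩
      refine ⟨{implClause a b}, _, by simpa using hab, Finset.filter_subset _ S, ?_,
        Finset.Subset.refl _, filter_mem_survive hbU h⟩
      rw [Finset.disjoint_singleton_left, Finset.mem_filter]
      unfold implClause
      split_ifs <;> simp
    refine (bernProb_mono h0 h1' fun S _ hS => hsub hS).trans ?_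
    refine (bernProb_disjOcc_le h0 h1 (isUpperSet_superset _) (isUpperSet_survive _ _ _ _)).trans ?_
    refine mul_le_mul ?_ (h _ _) (bernProb_nonneg h0 h1') h0
    simpa using bernProb_superset_le (C := C) h0 h1' {implClause a b} (k := 1) (by simp)
  have hU : survive n (k + 1) U a = ⋃ b ∈ pmSet n, E b := by
    ext S
    simp only [survive, hE, Set.mem_iUnion, Set.mem_ofPred_eq, exists_prop]
  have := prod_one_sub_le_bernProb (C := C) h0 h1' (pmSet n) hup
  rw [bernProb_compl, ← hU] at this
  have h2 : (1 - q * s) ^ (2 * n) ≤ ∏ b ∈ pmSet n, (1 - bernProb q C (E b)) := by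
    rw [← card_pmSet, ← Finset.prod_const]
    refine Finset.prod_le_prod (fun i _ => by nlinarith) fun i _ => by linarith [hprob i]
  linarith

lemma one_sub_pow_mul_le {x : ℝ} (h0 : 0 ≤ x) (h1 : x ≤ 1) (N : ℕ) :
    (1 - (1 - x) ^ N) * (1 + (N - 1) * x / 2) ≤ N * x := by
  suffices h : 1 - (N + 1) * x / 2 ≤ (1 - x) ^ N * (1 + (N - 1) * x / 2) by linarith
  induction N with
  | zero => simp; linarith
  | succ N ih =>
    have hp : 0 ≤ (1 - x) ^ N := pow_nonneg (by linarith) _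
    push_cast
    rcases Nat.eq_zero_or_pos N with rfl | hN
    · simp; linarith
    have hN : (1 : ℝ) ≤ N := by exact_mod_cast hN
    have hd : 0 < 1 + (N - 1) * x / 2 := by nlinarith
    have e : (1 - x) * (1 - (N + 1) * x / 2) * (1 + N * x / 2)
        = (1 - (N + 2) * x / 2) * (1 + (N - 1) * x / 2) + N * (N + 1) * x ^ 3 / 4 := by ring
    have h3 : 0 ≤ N * (N + 1) * x ^ 3 / 4 := by positivity
    have h4 : 0 ≤ (1 - x) * (1 + N * x / 2) := mul_nonneg (by linarith) (by positivity)
    have h5 := mul_le_mul_of_nonneg_left ih h4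
    have h6 : (1 - (N + 2) * x / 2) * (1 + (N - 1) * x / 2)
        ≤ ((1 - x) ^ (N + 1) * (1 + N * x / 2)) * (1 + (N - 1) * x / 2) := by
      rw [pow_succ]; linarith
    have := le_of_mul_le_mul_right h6 hd
    calc _ = 1 - (N + 2) * x / 2 := by ring
      _ ≤ _ := this
      _ = _ := by ring

lemma exists_survive_bound (h0 : 0 ≤ q) (h1 : q ≤ 1 / 2) (C : Finset (ℤ × ℤ)) {Λ : ℝ}
    (hn : 1 ≤ n) (hΛ1 : 1 ≤ Λ) (hΛ : 2 * n * q ≤ Λ) (k : ℕ) :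
    ∃ s : ℝ, 0 ≤ s ∧ s ≤ 1 ∧ k * s ≤ 4 * Λ ^ k ∧
      ∀ U a, bernProb q C (survive n k U a) ≤ s := by
  have h1' : q ≤ 1 := by linarith
  induction k with
  | zero => exact ⟨1, by simp, le_rfl, by simp, fun U a => bernProb_le_one h0 h1'⟩
  | succ k ih =>
    obtain ⟨s, hs0, hs1, hsk, hs⟩ := ih
    have hx0 : 0 ≤ q * s := by positivity
    have hx1 : q * s ≤ 1 := by nlinarith
    refine ⟨_, ?_, ?_, ?_, bernProb_survive_succ_le h0 h1 hs1 hs⟩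
    · have : (1 - q * s) ^ (2 * n) ≤ 1 := pow_le_one₀ (by linarith) (by linarith)
      linarith
    · have : 0 ≤ (1 - q * s) ^ (2 * n) := pow_nonneg (by linarith) _
      linarith
    · have hkey := one_sub_pow_mul_le hx0 hx1 (2 * n)
      set σ := 1 - (1 - q * s) ^ (2 * n)
      have hσ : 0 ≤ σ := by
        have : (1 - q * s) ^ (2 * n) ≤ 1 := pow_le_one₀ (by linarith) (by linarith)
        simp only [σ]; linarith
      have hn' : (1 : ℝ) ≤ n := by exact_mod_cast hn
      push_cast at hkey ⊢
      set y := 2 * n * (q * s) with hy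
      have hy0 : 0 ≤ y := by positivity
      have h2 : σ * (1 + y / 4) ≤ y := by
        refine le_trans (mul_le_mul_of_nonneg_left ?_ hσ) hkey
        rw [hy]; nlinarith
      have hM : 1 ≤ Λ ^ (k + 1) := one_le_pow₀ hΛ1
      have hky : k * y ≤ 4 * Λ ^ (k + 1) := by
        calc k * y = (2 * n * q) * (k * s) := by rw [hy]; ring
          _ ≤ Λ * (4 * Λ ^ k) := by gcongr
          _ = _ := by ring
      have h3 : (k + 1) * y ≤ 4 * Λ ^ (k + 1) * (1 + y / 4) := by nlinarith
      have h4 : ((k + 1) * σ) * (1 + y / 4) ≤ 4 * Λ ^ (k + 1) * (1 + y / 4) := by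
        refine le_trans ?_ h3
        rw [mul_assoc]
        gcongr
      exact le_of_mul_le_mul_right h4 (by positivity)

lemma mem_survive_of_isWalk {k : ℕ} {w : ℕ → ℤ} {U : Finset ℕ} (hw : IsWalk S w k)
    (hd : DistinctVars w (k + 1)) (hm : ∀ i ≤ k, w i ∈ pmSet n)
    (hU : ∀ i ≤ k, (w i).natAbs ∉ U) : S ∈ survive n k U (w 0) := by
  induction k generalizing w U with
  | zero => trivial
  | succ k ih =>
    have key : ∀ i ≤ k, (w (i + 1)).natAbs ∉ insert (w 0).natAbs U := by
      intro i hi h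
      rcases Finset.mem_insert.1 h with h | h
      · have := hd (i + 1) (by omega) 0 (by omega)
          (by rw [Int.abs_eq_natAbs, Int.abs_eq_natAbs, h])
        omega
      · exact hU (i + 1) (by omega) h
    refine ⟨w 1, hm 1 (by omega), key 0 (by omega), hw 0 (by omega), ?_⟩
    exact ih (w := fun i => w (i + 1)) (fun i hi => hw (i + 1) (by omega))
      (fun i hi j hj he => by simpa using hd (i + 1) (by omega) (j + 1) (by omega) he)
      (fun i hi => hm (i + 1) (by omega)) key

lemma implClause_walk_inj {w : ℕ → ℤ} {k i j : ℕ} (hd : DistinctVars w (k + 1)) (hi : i < k)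
    (hj : j < k) (h : implClause (w i) (w (i + 1)) = implClause (w j) (w (j + 1))) : i = j := by
  rcases implClause_inj h with ⟨h, -⟩ | ⟨h1, h2⟩
  · exact hd i (by omega) j (by omega) (by rw [h])
  · have := hd i (by omega) (j + 1) (by omega) (by rw [h1, abs_neg])
    have := hd (i + 1) (by omega) j (by omega) (by rw [h2, abs_neg])
    omega

/-- The literal `x` lies in the middle of a path of length `2 r`. -/
def central (n r : ℕ) (x : ℤ) : Set (Finset (ℤ × ℤ)) :=
  disjOcc (survive n r ∅ x) (survive n r ∅ (-x))

lemma mem_central_of_isWalk {r : ℕ} {w : ℕ → ℤ} (hw : IsWalk S w (2 * r))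
    (hd : DistinctVars w (2 * r + 1)) (hm : ∀ i ≤ 2 * r, w i ∈ pmSet n) :
    S ∈ central n r (w r) := by
  classical
  refine ⟨(Finset.range r).image fun i => implClause (w (r + i)) (w (r + i + 1)),
    (Finset.range r).image fun i => implClause (w i) (w (i + 1)), ?_, ?_, ?_, ?_, ?_⟩
  · intro c hc
    obtain ⟨i, hi, rfl⟩ := Finset.mem_image.1 hc
    exact hw _ (by have := Finset.mem_range.1 hi; omega)
  · intro c hc
    obtain ⟨i, hi, rfl⟩ := Finset.mem_image.1 hc
    exact hw _ (by have := Finset.mem_range.1 hi; omega)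
  · rw [Finset.disjoint_left]
    intro c hc hc'
    obtain ⟨i, hi, rfl⟩ := Finset.mem_image.1 hc
    obtain ⟨j, hj, he⟩ := Finset.mem_image.1 hc'
    rw [Finset.mem_range] at hi hj
    have := implClause_walk_inj hd (by omega) (by omega) he
    omega
  · refine mem_survive_of_isWalk (w := fun i => w (r + i)) ?_ ?_ ?_ (by simp)
    · intro i hi
      exact Finset.mem_image.2 ⟨i, by simpa using hi, rfl⟩
    · intro i hi j hj he
      have := hd (r + i) (by omega) (r + j) (by omega) he
      omega
    · exact fun i hi => hm _ (by omega)
  · refine mem_survive_of_isWalk (w := fun i => -w (r - i)) ?_ ?_ ?_ (by simp)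
    · intro i hi
      refine Finset.mem_image.2 ⟨r - (i + 1), by simp; omega, ?_⟩
      rw [show r - (i + 1) + 1 = r - i by omega]
      refine (implClause_neg fun he => ?_).symm
      have := hd _ (by omega) _ (by omega) he
      omega
    · intro i hi j hj he
      simp only [abs_neg] at he
      have := hd (r - i) (by omega) (r - j) (by omega) he
      omega
    · exact fun i hi => neg_mem_pmSet.2 (hm _ (by omega))

end Survival

section FirstMoment

variable {n : ℕ} {S : Finset (ℤ × ℤ)} {q : ℝ} {C : Finset (ℤ × ℤ)}

lemma bernProb_exists_word_le (h0 : 0 ≤ q) (h1 : q ≤ 1) (K : ℕ) (fam : ℕ → Finset ℤ)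
    {Q : (ℕ → ℤ) → Set (Finset (ℤ × ℤ))}
    (hcongr : ∀ w w', (∀ i < K, w i = w' i) → Q w ⊆ Q w') {b : ℝ}
    (hb : ∀ w, (∀ i < K, w i ∈ fam i) → bernProb q C (Q w) ≤ b) :
    bernProb q C {S | ∃ w, (∀ i < K, w i ∈ fam i) ∧ S ∈ Q w}
      ≤ (∏ i ∈ Finset.range K, ((fam i).card : ℝ)) * b := by
  classical
  set e : (Fin K → ℤ) → ℕ → ℤ := fun g i => if h : i < K then g ⟨i, h⟩ else 0 with he
  have hsub : {S | ∃ w, (∀ i < K, w i ∈ fam i) ∧ S ∈ Q w}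
      ⊆ ⋃ g ∈ Fintype.piFinset (fun i : Fin K => fam i), Q (e g) := by
    rintro S ⟨w, hw, hS⟩
    refine Set.mem_biUnion (x := fun i : Fin K => w i) ?_ (hcongr w _ ?_ hS)
    · simpa using fun i : Fin K => hw i i.2
    · intro i hi
      simp [he, hi]
  refine (bernProb_mono h0 h1 fun S _ hS => hsub hS).trans
    ((bernProb_biUnion_le h0 h1 _ _).trans ?_)
  refine (Finset.sum_le_card_nsmul _ _ b fun g hg => hb _ fun i hi => ?_).trans_eq ?_
  · have := Fintype.mem_piFinset.1 hg ⟨i, hi⟩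
    simpa [he, hi] using this
  · rw [Fintype.card_piFinset, nsmul_eq_mul, Finset.prod_range]
    push_cast
    rfl

lemma IsWalk.congr {w w' : ℕ → ℤ} {k : ℕ} (h : ∀ i < k + 1, w i = w' i) (hw : IsWalk S w k) :
    IsWalk S w' k := by
  intro i hi
  rw [← h i (by omega), ← h (i + 1) (by omega)]
  exact hw i hi

lemma DistinctVars.congr {w w' : ℕ → ℤ} {k : ℕ} (h : ∀ i < k, w i = w' i)
    (hw : DistinctVars w k) : DistinctVars w' k := by
  intro i hi j hj
  rw [← h i hi, ← h j hj]
  exact hw i hi j hj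

/-- The clauses of the walk `w 0 → ⋯ → w k`. -/
def walkClauses (w : ℕ → ℤ) (k : ℕ) : Finset (ℤ × ℤ) :=
  (Finset.range k).image fun i => implClause (w i) (w (i + 1))

lemma walkClauses_subset {w : ℕ → ℤ} {k : ℕ} (h : IsWalk S w k) : walkClauses w k ⊆ S := by
  intro c hc
  obtain ⟨i, hi, rfl⟩ := Finset.mem_image.1 hc
  exact h i (by simpa using hi)

lemma card_walkClauses {w : ℕ → ℤ} {k : ℕ} (hd : DistinctVars w (k + 1)) :
    (walkClauses w k).card = k := by
  rw [walkClauses, Finset.card_image_of_injOn, Finset.card_range]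
  intro i hi j hj h
  exact implClause_walk_inj hd (by simpa using hi) (by simpa using hj) h

lemma exit_notMem_walkClauses {w : ℕ → ℤ} {k : ℕ} {v : ℤ} (hd : DistinctVars w (k + 1))
    (h0 : w k ≠ 0) : implClause (w k) v ∉ walkClauses w k := by
  intro h
  obtain ⟨l, hl, he⟩ := Finset.mem_image.1 h
  rw [Finset.mem_range] at hl
  rcases implClause_inj he with ⟨h1, -⟩ | ⟨-, h2⟩
  · have := hd l (by omega) k (by omega) (by rw [h1])
    omega
  · have := hd (l + 1) (by omega) k (by omega) (by rw [h2, abs_neg])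
    subst this
    omega

lemma entry_notMem_walkClauses {w : ℕ → ℤ} {k : ℕ} {u : ℤ} (hd : DistinctVars w (k + 1))
    (h0 : w 0 ≠ 0) : implClause u (w 0) ∉ walkClauses w k := by
  intro h
  obtain ⟨l, hl, he⟩ := Finset.mem_image.1 h
  rw [Finset.mem_range] at hl
  rcases implClause_inj he with ⟨-, h1⟩ | ⟨h1, -⟩
  · have := hd (l + 1) (by omega) 0 (by omega) (by rw [h1])
    omega
  · have := hd l (by omega) 0 (by omega) (by rw [h1, abs_neg])
    subst this
    omega

lemma bernProb_walk_exit_le (h0 : 0 ≤ q) (h1 : q ≤ 1) {w : ℕ → ℤ} {k : ℕ} {v : ℤ}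
    (hw : w k ≠ 0) :
    bernProb q C {S | IsWalk S w k ∧ DistinctVars w (k + 1) ∧ implClause (w k) v ∈ S}
      ≤ q ^ (k + 1) := by
  classical
  by_cases hd : DistinctVars w (k + 1)
  · refine (bernProb_mono h0 h1 (B := {S | insert (implClause (w k) v) (walkClauses w k) ⊆ S})
      ?_).trans (bernProb_superset_le h0 h1 _ ?_)
    · rintro S - ⟨hS, -, hv⟩
      exact Finset.insert_subset hv (walkClauses_subset hS)
    · rw [Finset.card_insert_of_notMem (exit_notMem_walkClauses hd hw), card_walkClauses hd]
  · simp only [hd, false_and, and_false, Set.ofPred_false, bernProb_empty_event]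
    positivity

lemma bernProb_bicycle_le (h0 : 0 ≤ q) (h1 : q ≤ 1) {w : ℕ → ℤ} {k j : ℕ} {u : ℤ}
    (hw : w k ≠ 0) (hw0 : w 0 ≠ 0) (hj : j ≤ k) (hu : ∃ i ≤ k, |u| = |w i|) :
    bernProb q C {S | IsWalk S w k ∧ DistinctVars w (k + 1) ∧ implClause u (w 0) ∈ S ∧
      implClause (w k) (-w j) ∈ S} ≤ q ^ (k + 2) := by
  classical
  by_cases hd : DistinctVars w (k + 1)
  · refine (bernProb_mono h0 h1 (B := {S | insert (implClause u (w 0))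
      (insert (implClause (w k) (-w j)) (walkClauses w k)) ⊆ S}) ?_).trans
      (bernProb_superset_le h0 h1 _ ?_)
    · rintro S - ⟨hS, -, hu, hv⟩
      exact Finset.insert_subset hu (Finset.insert_subset hv (walkClauses_subset hS))
    · rw [Finset.card_insert_of_notMem, Finset.card_insert_of_notMem
        (exit_notMem_walkClauses hd hw), card_walkClauses hd]
      rw [Finset.mem_insert, not_or]
      refine ⟨fun he => ?_, entry_notMem_walkClauses hd hw0⟩
      rcases implClause_inj he with ⟨-, h⟩ | ⟨-, h⟩
      · have := hd 0 (by omega) j (by omega) (by rw [h, abs_neg])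
        subst this
        omega
      · have := hd 0 (by omega) k (by omega) (by rw [h, abs_neg])
        subst this
        omega
  · simp only [hd, false_and, and_false, Set.ofPred_false, bernProb_empty_event]
    positivity

/-- The event that there is a bicycle with prescribed sets of literals. -/
def bicycleEvent (fam : ℕ → Finset ℤ) (k : ℕ) : Set (Finset (ℤ × ℤ)) :=
  {S | ∃ W, (∀ i < k + 1, W i ∈ fam i) ∧ Bicycle S W k}

lemma Bicycle.mono {T : Finset (ℤ × ℤ)} {W : ℕ → ℤ} {k : ℕ} (hST : S ⊆ T) (h : Bicycle S W k) :
    Bicycle T W k := by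
  obtain ⟨h1, h2, ⟨u, i, hi, hui, hu⟩, j, hj, hv⟩ := h
  exact ⟨fun i hi => hST (h1 i hi), h2, ⟨u, i, hi, hui, hST hu⟩, j, hj, hST hv⟩

lemma isUpperSet_bicycleEvent (fam : ℕ → Finset ℤ) (k : ℕ) :
    IsUpperSet (bicycleEvent fam k) := by
  rintro S T hST ⟨W, hW, h⟩
  exact ⟨W, hW, h.mono hST⟩

lemma bernProb_bicycleEvent_le (h0 : 0 ≤ q) (h1 : q ≤ 1) (fam : ℕ → Finset ℤ) (k : ℕ)
    (hfam : ∀ i, fam i ⊆ pmSet n) :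
    bernProb q C (bicycleEvent fam k)
      ≤ 2 * (k + 1) ^ 2 * ((∏ i ∈ Finset.range (k + 1), ((fam i).card : ℝ)) * q ^ (k + 2)) := by
  classical
  set Q : ℕ × ℕ × ℤ → (ℕ → ℤ) → Set (Finset (ℤ × ℤ)) := fun p W =>
    {S | IsWalk S W k ∧ DistinctVars W (k + 1) ∧ implClause (p.2.2 * W p.1) (W 0) ∈ S ∧
      implClause (W k) (-W p.2.1) ∈ S} with hQ
  set I : Finset (ℕ × ℕ × ℤ) :=
    Finset.range (k + 1) ×ˢ Finset.range (k + 1) ×ˢ ({1, -1} : Finset ℤ) with hI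
  have hsub : bicycleEvent fam k
      ⊆ ⋃ p ∈ I, {S | ∃ W, (∀ i < k + 1, W i ∈ fam i) ∧ S ∈ Q p W} := by
    rintro S ⟨W, hW, hw, hd, ⟨u, i, hi, hui, hu⟩, j, hj, hv⟩
    rcases abs_eq_abs.1 hui with rfl | rfl
    · refine Set.mem_biUnion (x := (i, j, 1)) ?_ ⟨W, hW, hw, hd, by simpa using hu, hv⟩
      simp [hI]; omega
    · refine Set.mem_biUnion (x := (i, j, -1)) ?_ ⟨W, hW, hw, hd, by simpa using hu, hv⟩
      simp [hI]; omega
  refine (bernProb_mono h0 h1 fun S _ hS => hsub hS).trans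
    ((bernProb_biUnion_le h0 h1 _ _).trans ?_)
  refine (Finset.sum_le_card_nsmul I _ _ fun p hp => bernProb_exists_word_le h0 h1 _ _ ?_
    (b := q ^ (k + 2)) ?_).trans_eq ?_
  · rintro w w' h S ⟨hw, hd, hu, hv⟩
    simp only [hI, Finset.mem_product, Finset.mem_range] at hp
    refine ⟨hw.congr h, hd.congr h, ?_, ?_⟩
    · rwa [← h _ hp.1, ← h 0 (by omega)]
    · rwa [← h k (by omega), ← h _ hp.2.1]
  · intro w hw
    simp only [hI, Finset.mem_product, Finset.mem_range, Finset.mem_insert,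
      Finset.mem_singleton] at hp
    have hne : ∀ i ≤ k, w i ≠ 0 := fun i hi => (mem_pmSet.1 (hfam i (hw i (by omega)))).2
    refine bernProb_bicycle_le h0 h1 (hne k le_rfl) (hne 0 (by omega)) (by omega)
      ⟨p.1, by omega, ?_⟩
    rcases hp.2.2 with h | h <;> simp [h]
  · rw [nsmul_eq_mul, hI, Finset.card_product, Finset.card_product, Finset.card_range]
    simp only [Finset.card_pair (show (1 : ℤ) ≠ -1 by decide)]
    push_cast
    ring

/-- There is a lasso of length `t` with base `a`. -/
def lassoEvent (n : ℕ) (X : Finset ℤ) (a : ℤ) (t : ℕ) : Set (Finset (ℤ × ℤ)) :=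
  {S | ∃ w, w 0 = a ∧ (∀ i ≤ t, w i ∈ pmSet n) ∧ Lasso S X w t}

lemma isUpperSet_lassoEvent (n : ℕ) (X : Finset ℤ) (a : ℤ) (t : ℕ) :
    IsUpperSet (lassoEvent n X a t) := by
  rintro S T hST ⟨w, h0, hm, hw, h⟩
  exact ⟨w, h0, hm, fun i hi => hST (hw i hi), h⟩

lemma bernProb_lassoEvent_le (h0 : 0 ≤ q) (h1 : q ≤ 1) (L : Finset ℤ) {a : ℤ}
    (ha : a ∈ pmSet n) (t : ℕ) :
    bernProb q C (lassoEvent n L a t)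
      ≤ (t + 1 + L.card) * ((2 * n) ^ t * q ^ (t + 1)) := by
  classical
  set fam : ℕ → Finset ℤ := fun i => if i = 0 then {a} else pmSet n with hfam
  set Q : ℕ ⊕ ℤ → (ℕ → ℤ) → Set (Finset (ℤ × ℤ)) := fun p w =>
    {S | IsWalk S w t ∧ DistinctVars w (t + 1) ∧
      implClause (w t) (p.elim (fun j => -w j) fun v => -v) ∈ S} with hQ
  set I : Finset (ℕ ⊕ ℤ) := (Finset.range (t + 1)).disjSum L with hI
  have hfam' : ∀ i, fam i ⊆ pmSet n := by
    intro i
    by_cases h : i = 0 <;> simp [hfam, h, ha]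
  have hprod : (∏ i ∈ Finset.range (t + 1), ((fam i).card : ℝ)) = (2 * n) ^ t := by
    rw [Finset.prod_range_succ']
    simp [hfam, card_pmSet]
  have hsub : lassoEvent n L a t
      ⊆ ⋃ p ∈ I, {S | ∃ w, (∀ i < t + 1, w i ∈ fam i) ∧ S ∈ Q p w} := by
    rintro S ⟨w, hw0, hm, hw, hd, hlast⟩
    have hw' : IsWalk S w t := fun i hi => hw i (by omega)
    have hwf : ∀ i < t + 1, w i ∈ fam i := by
      intro i hi
      by_cases h : i = 0
      · simp [hfam, h, hw0]
      · simpa [hfam, h] using hm i (by omega)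
    rcases hlast with h | ⟨j, hj, h⟩
    · refine Set.mem_biUnion (x := Sum.inr (-w (t + 1))) ?_ ⟨w, hwf, hw', hd, ?_⟩
      · simpa [hI] using h
      · simpa using hw t (by omega)
    · refine Set.mem_biUnion (x := Sum.inl j) ?_ ⟨w, hwf, hw', hd, ?_⟩
      · simp [hI]; omega
      · simpa [← h] using hw t (by omega)
  refine (bernProb_mono h0 h1 fun S _ hS => hsub hS).trans
    ((bernProb_biUnion_le h0 h1 _ _).trans ?_)
  refine (Finset.sum_le_card_nsmul I _ _ fun p hp => bernProb_exists_word_le h0 h1 _ _ ?_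
    (b := q ^ (t + 1)) ?_).trans_eq ?_
  · rintro w w' h S ⟨hw, hd, hv⟩
    refine ⟨hw.congr h, hd.congr h, ?_⟩
    rw [← h t (by omega)]
    rcases p with j | v
    · have hj : j < t + 1 := by simpa [hI] using hp
      simpa [← h j hj] using hv
    · exact hv
  · intro w hw
    exact bernProb_walk_exit_le h0 h1 (mem_pmSet.1 (hfam' t (hw t (by omega)))).2
  · rw [nsmul_eq_mul, hprod, hI, Finset.card_disjSum, Finset.card_range]
    push_cast
    ring

end FirstMoment

section Threshold

variable {n r : ℕ} {S : Finset (ℤ × ℤ)} {q : ℝ}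

/-- The literals allowed at position `i` of a bicycle of size `k`: those far from both ends avoid
the first `t` variables. -/
def bicycleFamily (n r t k i : ℕ) : Finset ℤ :=
  if r ≤ i ∧ i + r ≤ k then pmSet n \ pmSet t else pmSet n

lemma bicycleFamily_subset (n r t k i : ℕ) : bicycleFamily n r t k i ⊆ pmSet n := by
  unfold bicycleFamily
  split_ifs
  · exact Finset.sdiff_subset
  · exact subset_rfl

lemma mem_of_unsat {t : ℕ} (hS : S ⊆ clauseSet n) (h : S ∈ unsatFixed ∅) :
    S ∈ (⋃ x ∈ pmSet t, central n r x) ∪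
      ⋃ k ∈ Finset.range n, bicycleEvent (bicycleFamily n r t k) k := by
  obtain ⟨W, k, hW⟩ := exists_bicycle_of_unsat hS h
  have hm := hW.1.mem_pmSet hS (hW.zero_mem hS)
  by_cases hi : ∃ i, r ≤ i ∧ i + r ≤ k ∧ W i ∈ pmSet t
  · obtain ⟨i, hri, hik, hi⟩ := hi
    refine Or.inl (Set.mem_biUnion hi ?_)
    have := mem_central_of_isWalk (S := S) (n := n) (r := r) (w := fun m => W (i - r + m))
      (fun j hj => hW.1 (i - r + j) (by omega))
      (fun a ha b hb he => by
        have := hW.2.1 (i - r + a) (by omega) (i - r + b) (by omega) he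
        omega)
      (fun j hj => hm _ (by omega))
    simpa [Nat.sub_add_cancel hri] using this
  · push Not at hi
    have hkn : k + 1 ≤ n := hW.2.1.le fun i hi => hm i (by omega)
    refine Or.inr (Set.mem_biUnion (x := k) (by simpa using hkn) ⟨W, fun i hik => ?_, hW⟩)
    unfold bicycleFamily
    split_ifs with h
    · exact Finset.mem_sdiff.2 ⟨hm i (by omega), hi i h.1 h.2⟩
    · exact hm i (by omega)

lemma mul_le_one_sub_bernProb_unsat (h0 : 0 ≤ q) (h1 : q ≤ 1) (n r t : ℕ) :
    bernProb q (clauseSet n) (⋃ x ∈ pmSet t, central n r x)ᶜ *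
      bernProb q (clauseSet n) (⋃ k ∈ Finset.range n, bicycleEvent (bicycleFamily n r t k) k)ᶜ
      ≤ 1 - bernProb q (clauseSet n) (unsatFixed ∅) := by
  rw [← bernProb_compl]
  refine (mul_bernProb_le_inter h0 h1 ?_ ?_).trans (bernProb_mono h0 h1 fun S hS h hu => ?_)
  · exact (isUpperSet_iUnion₂ fun _ _ => isUpperSet_disjOcc).compl
  · exact (isUpperSet_iUnion₂ fun _ _ => isUpperSet_bicycleEvent _ _).compl
  · rcases mem_of_unsat hS hu with hu | hu
    · exact h.1 hu
    · exact h.2 hu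

lemma one_add_two_div_pow_le (hr : 1 ≤ r) : (1 + 2 / (r : ℝ)) ^ r ≤ Real.exp 2 := by
  have hr' : (0 : ℝ) < r := by exact_mod_cast hr
  calc (1 + 2 / (r : ℝ)) ^ r ≤ Real.exp (2 / r) ^ r := by
        gcongr; linarith [Real.add_one_le_exp (2 / (r : ℝ))]
    _ = Real.exp 2 := by rw [← Real.exp_nat_mul]; congr 1; field_simp

lemma exp_two_le : Real.exp 2 ≤ 8 := by
  have h := Real.exp_one_lt_d9
  have : Real.exp 2 = Real.exp 1 * Real.exp 1 := by rw [← Real.exp_add]; norm_num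
  rw [this]
  nlinarith [Real.exp_pos 1]

lemma bernProb_survive_le (h0 : 0 ≤ q) (h1 : q ≤ 1 / 2) (C : Finset (ℤ × ℤ)) (hn : 1 ≤ n)
    (hr : 1 ≤ r) (hq : 2 * n * q ≤ 1 + 2 / r) (U : Finset ℕ) (a : ℤ) :
    bernProb q C (survive n r U a) ≤ 32 / r := by
  have hr' : (0 : ℝ) < r := by exact_mod_cast hr
  have hΛ : (1 : ℝ) ≤ 1 + 2 / r := by
    have : 0 ≤ 2 / (r : ℝ) := by positivity
    linarith
  obtain ⟨s, -, -, hs, h⟩ := exists_survive_bound h0 h1 C hn hΛ hq r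
  refine (h U a).trans ?_
  rw [le_div_iff₀ hr']
  linarith [one_add_two_div_pow_le hr, exp_two_le]

lemma bernProb_central_le (h0 : 0 ≤ q) (h1 : q ≤ 1 / 2) (C : Finset (ℤ × ℤ)) (hn : 1 ≤ n)
    (hr : 1 ≤ r) (hq : 2 * n * q ≤ 1 + 2 / r) (x : ℤ) :
    bernProb q C (central n r x) ≤ 1024 / r ^ 2 := by
  refine (bernProb_disjOcc_le h0 h1 (isUpperSet_survive _ _ _ _)
    (isUpperSet_survive _ _ _ _)).trans ?_
  have h := bernProb_survive_le h0 h1 C hn hr hq ∅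
  refine (mul_le_mul (h x) (h (-x)) (bernProb_nonneg h0 (by linarith)) (by positivity)).trans_eq ?_
  ring

lemma pmSet_mono {t : ℕ} (h : t ≤ n) : pmSet t ⊆ pmSet n := by
  intro l hl
  rw [mem_pmSet] at hl ⊢
  exact ⟨hl.1.trans (by exact_mod_cast h), hl.2⟩

lemma prod_bicycleFamily_le (h0 : 0 ≤ q) {t k : ℕ} {Λ μ : ℝ} (hΛ1 : 1 ≤ Λ) (hμ0 : 0 ≤ μ)
    (htn : t ≤ n) (hΛ : 2 * n * q ≤ Λ) (hμ : 2 * (n - t) * q ≤ μ) :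
    (∏ i ∈ Finset.range (k + 1), ((bicycleFamily n r t k i).card : ℝ)) * q ^ (k + 1)
      ≤ Λ ^ (2 * r) * μ ^ (k + 1 - 2 * r) := by
  classical
  have hstep : (∏ i ∈ Finset.range (k + 1), ((bicycleFamily n r t k i).card : ℝ)) * q ^ (k + 1)
      ≤ ∏ i ∈ Finset.range (k + 1), if r ≤ i ∧ i + r ≤ k then μ else Λ := by
    nth_rw 2 [← Finset.card_range (k + 1)]
    rw [← Finset.prod_const, ← Finset.prod_mul_distrib]
    refine Finset.prod_le_prod (fun i _ => by positivity) fun i _ => ?_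
    unfold bicycleFamily
    split_ifs
    · rw [Finset.card_sdiff_of_subset (pmSet_mono htn), card_pmSet, card_pmSet,
        Nat.cast_sub (by omega)]
      push_cast
      linarith
    · rw [card_pmSet]
      push_cast
      linarith
  refine hstep.trans ?_
  rw [Finset.prod_ite, Finset.prod_const, Finset.prod_const, mul_comm]
  have hcard : ((Finset.range (k + 1)).filter fun i => r ≤ i ∧ i + r ≤ k).card
      = k + 1 - 2 * r := by
    rw [show ((Finset.range (k + 1)).filter fun i => r ≤ i ∧ i + r ≤ k)
      = Finset.Ico r (k + 1 - r) by ext i; simp; omega, Nat.card_Ico]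
    omega
  have hcard' : ((Finset.range (k + 1)).filter fun i => ¬ (r ≤ i ∧ i + r ≤ k)).card
      ≤ 2 * r := by
    have := Finset.card_filter_add_card_filter_not (s := Finset.range (k + 1))
      fun i => r ≤ i ∧ i + r ≤ k
    rw [hcard, Finset.card_range] at this
    omega
  rw [hcard]
  gcongr

end Threshold

section LowerBound

variable {n r : ℕ} {q : ℝ}

lemma pow_sub_le_exp {μ : ℝ} (hr : 1 ≤ r) (hμ0 : 0 ≤ μ) (hμ : μ ≤ 1 - 1 / r) (K : ℕ) :
    μ ^ (K - 2 * r) ≤ Real.exp (2 - K / r) := by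
  have hr' : (0 : ℝ) < r := by exact_mod_cast hr
  rcases le_total (2 * r) K with h | h
  · calc μ ^ (K - 2 * r) ≤ Real.exp (-(1 / r)) ^ (K - 2 * r) := by
          gcongr; linarith [Real.add_one_le_exp (-(1 / (r : ℝ)))]
      _ = _ := by
          rw [← Real.exp_nat_mul, Nat.cast_sub h]; congr 1; push_cast; field_simp; ring
  · rw [Nat.sub_eq_zero_of_le h, pow_zero]
    refine Real.one_le_exp ?_
    have : (K : ℝ) ≤ 2 * r := by exact_mod_cast h
    rw [sub_nonneg, div_le_iff₀ hr']
    exact this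

lemma sq_mul_exp_le (hr : 1 ≤ r) (K : ℕ) :
    (K : ℝ) ^ 2 * Real.exp (-(K / r)) ≤ 9 * r ^ 2 * Real.exp (-(1 / (3 * r))) ^ K := by
  have hr' : (0 : ℝ) < r := by exact_mod_cast hr
  set y : ℝ := K / (3 * r) with hy
  have hK : (K : ℝ) = 3 * r * y := by rw [hy]; field_simp
  have hy0 : 0 ≤ y := by positivity
  have h1 : y ≤ Real.exp y := by linarith [Real.add_one_le_exp y]
  have h2 : y ^ 2 ≤ Real.exp y ^ 2 := by gcongr
  rw [← Real.exp_nat_mul]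
  rw [show -((K : ℝ) / r) = -y + (-y + -y) by rw [hK]; field_simp; ring,
    show (K : ℝ) * -(1 / (3 * r)) = -y by rw [hy]; field_simp]
  rw [Real.exp_add, Real.exp_add, hK]
  have h3 : y ^ 2 * (Real.exp (-y) * Real.exp (-y)) ≤ 1 := by
    calc _ ≤ Real.exp y ^ 2 * (Real.exp (-y) * Real.exp (-y)) := by gcongr
      _ = 1 := by rw [Real.exp_neg]; field_simp
  calc (3 * r * y) ^ 2 * (Real.exp (-y) * (Real.exp (-y) * Real.exp (-y)))
      = 9 * r ^ 2 * Real.exp (-y) * (y ^ 2 * (Real.exp (-y) * Real.exp (-y))) := by ring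
    _ ≤ 9 * r ^ 2 * Real.exp (-y) * 1 := by gcongr
    _ = _ := by ring

lemma sum_exp_pow_le (hr : 1 ≤ r) (n : ℕ) :
    ∑ k ∈ Finset.range n, Real.exp (-(1 / (3 * (r : ℝ)))) ^ (k + 1) ≤ 6 * r := by
  have hr' : (1 : ℝ) ≤ r := by exact_mod_cast hr
  set x : ℝ := 1 / (3 * r) with hx
  have hx0 : 0 < x := by positivity
  have hρ : Real.exp (-x) ≤ 3 * r / (3 * r + 1) := by
    rw [Real.exp_neg]
    refine inv_le_of_inv_le₀ (by positivity) ?_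
    rw [inv_div]
    refine le_trans (le_of_eq ?_) (Real.add_one_le_exp x)
    rw [hx]; field_simp; ring
  have hρ' : (1 : ℝ) ≤ (1 - Real.exp (-x)) * (6 * r) := by
    have : 1 / (3 * r + 1) ≤ 1 - Real.exp (-x) := by
      have e : 1 / (3 * (r : ℝ) + 1) = 1 - 3 * r / (3 * r + 1) := by field_simp; ring
      rw [e]; linarith
    calc (1 : ℝ) ≤ 1 / (3 * r + 1) * (6 * r) := by
          rw [div_mul_eq_mul_div, le_div_iff₀ (by positivity)]; linarith
      _ ≤ _ := by gcongr
  have hρ1 : 0 < 1 - Real.exp (-x) := by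
    have : Real.exp (-x) < 1 := Real.exp_lt_one_iff.2 (by linarith)
    linarith
  have hg := geom_sum_mul_neg (Real.exp (-x)) n
  have hle : (∑ k ∈ Finset.range n, Real.exp (-x) ^ k) ≤ 6 * r := by
    refine le_of_mul_le_mul_right ?_ hρ1
    rw [hg]
    have := pow_pos (Real.exp_pos (-x)) n
    linarith
  refine le_trans (Finset.sum_le_sum fun k _ => ?_) hle
  rw [pow_succ]
  exact mul_le_of_le_one_right (by positivity) (by linarith)

/-- Uniform lower bound for the probability that a random set of clauses at the upper end of the
critical window is satisfiable. -/
lemma exp_le_one_sub_bernProb_unsat (h0 : 0 ≤ q) (h1 : q ≤ 1 / 2) (hn : n ≤ r ^ 3)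
    (hn' : r ^ 3 ≤ 8 * n) (hr : 46 ≤ r) (hr' : 288 * Real.exp 6 ≤ r)
    (hq : 2 * n * q ≤ 1 + 2 / r) :
    Real.exp (-12288) * Real.exp (-(1728 * Real.exp 6))
      ≤ 1 - bernProb q (clauseSet n) (unsatFixed ∅) := by
  have h1' : q ≤ 1 := by linarith
  have hR : (46 : ℝ) ≤ r := by exact_mod_cast hr
  have hR0 : (0 : ℝ) < r := by linarith
  have htn : 3 * r ^ 2 ≤ n := by nlinarith [sq_nonneg r]
  have hn1 : 1 ≤ n := by nlinarith
  have hN : (n : ℝ) ≤ r ^ 3 := by exact_mod_cast hn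
  have hN' : (r : ℝ) ^ 3 ≤ 8 * n := by exact_mod_cast hn'
  have hN1 : (1 : ℝ) ≤ n := by exact_mod_cast hn1
  have hinv : 1 / (r : ℝ) ≤ 1 / 46 := by gcongr
  have hΛ1 : (1 : ℝ) ≤ 1 + 2 / r := by
    have : 0 ≤ 2 / (r : ℝ) := by positivity
    linarith
  refine le_trans ?_ (mul_le_one_sub_bernProb_unsat h0 h1' n r (3 * r ^ 2))
  refine mul_le_mul ?_ ?_ (Real.exp_pos _).le (bernProb_nonneg h0 h1')
  · refine le_trans (le_of_eq ?_) (exp_le_bernProb_compl_biUnion h0 h1' (pmSet (3 * r ^ 2))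
      (fun x => isUpperSet_disjOcc) (b := fun _ => 1024 / r ^ 2)
      (fun x _ => bernProb_central_le h0 h1 _ hn1 (by omega) hq x) fun _ _ => ?_)
    · rw [Finset.sum_const, card_pmSet, nsmul_eq_mul]
      push_cast
      congr 1
      field_simp
      norm_num
    · rw [div_le_iff₀ (by positivity)]
      nlinarith
  · set ρ := Real.exp (-(1 / (3 * (r : ℝ)))) with hρ
    have hρ0 : 0 < ρ := Real.exp_pos _
    have hρ1 : ρ ≤ 1 := Real.exp_le_one_iff.2 (by
      have : 0 ≤ 1 / (3 * (r : ℝ)) := by positivity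
      linarith)
    set A : ℝ := 18 * Real.exp 6 * r ^ 2 / n with hA
    have hA0 : 0 ≤ A := by positivity
    have hAr : A * r ≤ 144 * Real.exp 6 := by
      rw [hA, div_mul_eq_mul_div, div_le_iff₀ (by linarith)]
      nlinarith [Real.exp_pos 6]
    have hqn : q ≤ 1 / n := by
      rw [le_div_iff₀ (by linarith)]
      have : 2 / (r : ℝ) = 2 * (1 / r) := by ring
      nlinarith
    have hbound : ∀ k ∈ Finset.range n,
        bernProb q (clauseSet n) (bicycleEvent (bicycleFamily n r (3 * r ^ 2) k) k)
          ≤ A * ρ ^ (k + 1) := by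
      intro k _
      refine (bernProb_bicycleEvent_le h0 h1' _ k (bicycleFamily_subset n r _ k)).trans ?_
      have hμ0 : (0 : ℝ) ≤ 1 - 1 / r := by linarith
      have hμ : 2 * ((n : ℝ) - (3 * r ^ 2 : ℕ)) * q ≤ 1 - 1 / r := by
        have h3 : 3 / (r : ℝ) ≤ (3 * r ^ 2 : ℕ) / (n : ℝ) := by
          push_cast
          rw [div_le_div_iff₀ hR0 (by linarith)]
          nlinarith
        have h4 : (3 * r ^ 2 : ℕ) / (n : ℝ) ≤ 1 := by
          rw [div_le_one (by linarith)]
          exact_mod_cast htn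
        calc 2 * ((n : ℝ) - (3 * r ^ 2 : ℕ)) * q
            = (2 * n * q) * (1 - (3 * r ^ 2 : ℕ) / (n : ℝ)) := by field_simp
          _ ≤ (1 + 2 / r) * (1 - 3 / r) := by
              refine mul_le_mul hq (by linarith) (by linarith) (by linarith)
          _ = 1 - 1 / r - 6 * (1 / r) ^ 2 := by ring
          _ ≤ 1 - 1 / r := by nlinarith [sq_nonneg (1 / (r : ℝ))]
      have hprod := prod_bicycleFamily_le (r := r) (k := k) h0 hΛ1 hμ0 htn hq hμ
      have hΛ2 : (1 + 2 / (r : ℝ)) ^ (2 * r) ≤ Real.exp 4 := by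
        rw [mul_comm, pow_mul]
        calc _ ≤ Real.exp 2 ^ 2 := by
              gcongr; exact one_add_two_div_pow_le (by omega)
          _ = _ := by rw [← Real.exp_nat_mul]; norm_num
      have hμ2 := pow_sub_le_exp (r := r) (by omega) hμ0 le_rfl (k + 1)
      have hsq := sq_mul_exp_le (r := r) (by omega) (k + 1)
      push_cast at hμ2 hsq
      calc 2 * (k + 1 : ℝ) ^ 2 * ((∏ i ∈ Finset.range (k + 1),
            ((bicycleFamily n r (3 * r ^ 2) k i).card : ℝ)) * q ^ (k + 2))
          = 2 * (k + 1 : ℝ) ^ 2 * (((∏ i ∈ Finset.range (k + 1),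
            ((bicycleFamily n r (3 * r ^ 2) k i).card : ℝ)) * q ^ (k + 1)) * q) := by ring
        _ ≤ 2 * (k + 1 : ℝ) ^ 2 *
            ((Real.exp 4 * Real.exp (2 - (k + 1) / r)) * (1 / n)) := by
            refine mul_le_mul_of_nonneg_left ?_ (by positivity)
            exact mul_le_mul (hprod.trans (by gcongr)) hqn h0 (by positivity)
        _ = 2 * Real.exp 6 / n * ((k + 1 : ℝ) ^ 2 * Real.exp (-((k + 1) / r))) := by
            rw [sub_eq_add_neg, Real.exp_add, show (6 : ℝ) = 4 + 2 by norm_num, Real.exp_add]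
            ring
        _ ≤ 2 * Real.exp 6 / n * (9 * r ^ 2 * ρ ^ (k + 1)) := by gcongr
        _ = A * ρ ^ (k + 1) := by rw [hA]; ring
    refine le_trans ?_ (exp_le_bernProb_compl_biUnion h0 h1' (Finset.range n)
      (fun k => isUpperSet_bicycleEvent _ _) hbound fun k _ => ?_)
    · rw [Real.exp_le_exp, ← Finset.mul_sum]
      have := mul_le_mul_of_nonneg_left (sum_exp_pow_le (r := r) (by omega) n) hA0
      linarith
    · have h2 : A * ρ ^ (k + 1) ≤ A := mul_le_of_le_one_right hA0 (pow_le_one₀ hρ0.le hρ1)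
      refine h2.trans ?_
      refine le_of_mul_le_mul_right (hAr.trans ?_) hR0
      linarith

end LowerBound

section Fixing

variable {n r : ℕ} {S : Finset (ℤ × ℤ)} {q : ℝ} {L : Finset ℤ}

/-- Some literal of `L` starts a long path or a short lasso. -/
def spreadEvent (n r : ℕ) (L : Finset ℤ) : Set (Finset (ℤ × ℤ)) :=
  (⋃ a ∈ L, survive n r ∅ a) ∪ ⋃ p ∈ L ×ˢ Finset.range r, lassoEvent n L p.1 p.2

lemma isUpperSet_spreadEvent (n r : ℕ) (L : Finset ℤ) : IsUpperSet (spreadEvent n r L) :=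
  (isUpperSet_iUnion₂ fun _ _ => isUpperSet_survive _ _ _ _).union
    (isUpperSet_iUnion₂ fun _ _ => isUpperSet_lassoEvent _ _ _ _)

lemma mem_spreadEvent (hS : S ⊆ clauseSet n) (hL : Consistent n L) (h : S ∈ unsatFixed L)
    (h' : S ∉ unsatFixed ∅) : S ∈ spreadEvent n r L := by
  obtain ⟨a, ha, b, hb, hab⟩ := exists_reach_of_unsatFixed hS h' h
  obtain ⟨w, t, hw0, hw⟩ := exists_lasso (X := L) (by simpa using hL.2 a ha)
    (by simpa using hb) hab
  have hm : ∀ i ≤ t + 1, w i ∈ pmSet n := hw.1.mem_pmSet hS (hw0 ▸ hL.1 ha)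
  rcases lt_or_ge t r with htr | htr
  · exact Or.inr (Set.mem_biUnion (x := (a, t))
      (by simpa using ⟨ha, htr⟩) ⟨w, hw0, fun i hi => hm i (by omega), hw⟩)
  · refine Or.inl (Set.mem_biUnion ha ?_)
    rw [← hw0]
    exact mem_survive_of_isWalk (fun i hi => hw.1 i (by omega))
      (fun i hi j hj => hw.2.1 i (by omega) j (by omega)) (fun i hi => hm i (by omega)) (by simp)

lemma bernProb_spreadEvent_le (h0 : 0 ≤ q) (h1 : q ≤ 1 / 2) (hn' : r ^ 3 ≤ 8 * n) (hr : 2 ≤ r)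
    (hq : 2 * n * q ≤ 1 + 2 / r) (C : Finset (ℤ × ℤ)) (hL : L ⊆ pmSet n) :
    bernProb q C (spreadEvent n r L) ≤ 96 * (L.card / r) + 64 * (L.card / r) ^ 2 := by
  have h1' : q ≤ 1 := by linarith
  have hR : (2 : ℝ) ≤ r := by exact_mod_cast hr
  have hR0 : (0 : ℝ) < r := by linarith
  have hn1 : 1 ≤ n := by
    have : 2 ^ 3 ≤ r ^ 3 := Nat.pow_le_pow_left hr 3
    omega
  have hN' : (r : ℝ) ^ 3 ≤ 8 * n := by exact_mod_cast hn'
  have hN1 : (1 : ℝ) ≤ n := by exact_mod_cast hn1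
  have hΛ1 : (1 : ℝ) ≤ 1 + 2 / r := by
    have : 0 ≤ 2 / (r : ℝ) := by positivity
    linarith
  have hqn : q ≤ 8 / r ^ 3 := by
    rw [le_div_iff₀ (by positivity)]
    have : 2 / (r : ℝ) ≤ 1 := by rw [div_le_one hR0]; exact hR
    nlinarith
  have hlasso : ∀ p ∈ L ×ˢ Finset.range r, bernProb q C (lassoEvent n L p.1 p.2)
      ≤ (r + L.card) * (8 * (8 / r ^ 3)) := by
    intro p hp
    simp only [Finset.mem_product, Finset.mem_range] at hp
    refine (bernProb_lassoEvent_le h0 h1' L (hL hp.1) p.2).trans ?_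
    have ht : (p.2 : ℝ) + 1 ≤ r := by exact_mod_cast hp.2
    rw [pow_succ, ← mul_assoc ((2 * (n : ℝ)) ^ p.2), ← mul_pow]
    have h8 : (2 * n * q) ^ p.2 ≤ 8 := by
      calc (2 * n * q) ^ p.2 ≤ (1 + 2 / (r : ℝ)) ^ p.2 := by gcongr
        _ ≤ (1 + 2 / (r : ℝ)) ^ r := pow_le_pow_right₀ hΛ1 hp.2.le
        _ ≤ 8 := (one_add_two_div_pow_le (by omega)).trans exp_two_le
    gcongr
  have e1 := (bernProb_biUnion_le (C := C) h0 h1' L fun a => survive n r ∅ a).trans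
    (Finset.sum_le_card_nsmul _ _ _ fun a _ => bernProb_survive_le h0 h1 C hn1 (by omega) hq ∅ a)
  have e2 := (bernProb_biUnion_le h0 h1' _ _).trans (Finset.sum_le_card_nsmul _ _ _ hlasso)
  have e3 := bernProb_union_add_inter (q := q) (C := C)
    (A := ⋃ a ∈ L, survive n r ∅ a)
    (B := ⋃ p ∈ L ×ˢ Finset.range r, lassoEvent n L p.1 p.2)
  have e4 := bernProb_nonneg (C := C) h0 h1' (A := (⋃ a ∈ L, survive n r ∅ a) ∩
    ⋃ p ∈ L ×ˢ Finset.range r, lassoEvent n L p.1 p.2)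
  rw [nsmul_eq_mul] at e1 e2
  rw [Finset.card_product, Finset.card_range] at e2
  push_cast at e2
  have e5 : (L.card : ℝ) * (32 / r) + L.card * r * ((r + L.card) * (8 * (8 / r ^ 3)))
      = 96 * (L.card / r) + 64 * (L.card / r) ^ 2 := by
    field_simp
    ring
  rw [spreadEvent]
  linarith

end Fixing

section Transfer

variable {n m r : ℕ} {S : Finset (ℤ × ℤ)} {L : Finset ℤ}

lemma isUpperSet_unsatFixed (L : Finset ℤ) : IsUpperSet (unsatFixed L) := by
  rintro S T hST hS ⟨x, hx⟩
  exact hS ⟨x, fun c hc => hx c (hST hc)⟩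

lemma unsatFixed_empty_subset (L : Finset ℤ) : unsatFixed ∅ ⊆ unsatFixed L := by
  rintro S hS ⟨x, hx⟩
  exact hS ⟨fixAssign L x, fun c hc => by simpa only [fixAssign_empty] using hx c hc⟩

lemma probSatFixed_eq (n m : ℕ) (L : Finset ℤ) (hC : (clauseSet n).Nonempty) :
    probSatFixed n m L = 1 - drawProb (clauseSet n) m (unsatFixed L) := by
  classical
  have hcard : Fintype.card (CNF2 n m) = (clauseSet n).card ^ m := by
    have : Fintype.card (Fin m → clauseSet n) = (clauseSet n).card ^ m := by simp
    rw [← this]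
    exact Fintype.card_congr (Equiv.refl _)
  have hunsat : ∀ φ : CNF2 n m, ¬ SatFixed L φ ↔
      (fun j => (φ j : ℤ × ℤ)) ∈ drawSet (clauseSet n) m (unsatFixed L) := by
    intro φ
    simp only [mem_drawSet, unsatFixed, SatFixed, Set.mem_ofPred_eq, Finset.mem_image,
      Finset.mem_univ, true_and, forall_exists_index, forall_apply_eq_imp_iff]
    exact ⟨fun h => ⟨fun j => (φ j).2, h⟩, fun h => h.2⟩
  have hdraw : (drawSet (clauseSet n) m (unsatFixed L)).card
      = Nat.card {φ : CNF2 n m // ¬ SatFixed L φ} := by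
    rw [Nat.card_eq_fintype_card, Fintype.card_subtype]
    refine (Finset.card_bij (fun φ _ j => (φ j : ℤ × ℤ)) ?_ ?_ ?_).symm
    · intro φ hφ
      exact (hunsat φ).1 (by simpa using hφ)
    · intro φ _ ψ _ h
      funext j
      exact Subtype.ext (congrFun h j)
    · intro g hg
      refine ⟨fun j => ⟨g j, (mem_drawSet.1 hg).1 j⟩, ?_, rfl⟩
      exact Finset.mem_filter.2 ⟨Finset.mem_univ _, (hunsat _).2 hg⟩
  have hsum : Nat.card {φ : CNF2 n m // SatFixed L φ} +
      Nat.card {φ : CNF2 n m // ¬ SatFixed L φ} = Fintype.card (CNF2 n m) := by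
    rw [Nat.card_eq_fintype_card, Nat.card_eq_fintype_card, Fintype.card_subtype_compl]
    have := Fintype.card_subtype_le (α := CNF2 n m) (SatFixed L)
    omega
  have hpos : (0 : ℝ) < (clauseSet n).card ^ m := by
    have := hC.card_pos
    positivity
  rw [probSatFixed, drawProb, hdraw, hcard, eq_sub_iff_add_eq]
  push_cast
  rw [← add_div, div_eq_one_iff_eq hpos.ne']
  exact_mod_cast hsum.trans hcard

lemma le_card_clauseSet (n : ℕ) : 4 * n ^ 2 ≤ 2 * (clauseSet n).card + 4 * n := by
  classical
  set P := pmSet n ×ˢ pmSet n with hP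
  have hPc : P.card = 4 * n ^ 2 := by rw [hP, Finset.card_product, card_pmSet]; ring
  have hsub : P ⊆ clauseSet n ∪ (clauseSet n).image Prod.swap ∪
      (pmSet n ×ˢ ({1, -1} : Finset ℤ)).image fun p => (p.1, p.2 * p.1) := by
    rintro ⟨a, b⟩ hab
    simp only [hP, Finset.mem_product] at hab
    simp only [Finset.mem_union, Finset.mem_image, mem_clauseSet]
    rcases lt_trichotomy |a| |b| with h | h | h
    · exact Or.inl (Or.inl ⟨hab.1, hab.2, h⟩)
    · refine Or.inr ?_
      rcases abs_eq_abs.1 h with h | h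
      · exact ⟨(a, 1), by simp [hab.1], by simp [h]⟩
      · exact ⟨(a, -1), by simp [hab.1], by simp [h]⟩
    · exact Or.inl (Or.inr ⟨(b, a), ⟨hab.2, hab.1, h⟩, rfl⟩)
  have h1 := Finset.card_le_card hsub
  have h2 := Finset.card_union_le (clauseSet n ∪ (clauseSet n).image Prod.swap)
    ((pmSet n ×ˢ ({1, -1} : Finset ℤ)).image fun p => (p.1, p.2 * p.1))
  have h3 := Finset.card_union_le (clauseSet n) ((clauseSet n).image Prod.swap)
  have h4 := Finset.card_image_le (s := clauseSet n) (f := Prod.swap)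
  have h5 := Finset.card_image_le (s := pmSet n ×ˢ ({1, -1} : Finset ℤ))
    (f := fun p => (p.1, p.2 * p.1))
  rw [Finset.card_product, card_pmSet, Finset.card_pair (by decide)] at h5
  omega

lemma one_add_pow_mul_exp_le {δ : ℝ} (h0 : 0 ≤ δ) (h1 : δ ≤ 1) (n : ℕ) :
    (1 + δ) ^ n * Real.exp (-(n * δ)) ≤ Real.exp (-(n * δ ^ 2 / 4)) := by
  have h : 1 + δ ≤ Real.exp (δ - δ ^ 2 / 4) := by
    have hx : 0 ≤ δ - δ ^ 2 / 4 := by nlinarith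
    have hx' : 3 / 4 * δ ≤ δ - δ ^ 2 / 4 := by nlinarith
    have := Real.quadratic_le_exp_of_nonneg hx
    nlinarith
  calc (1 + δ) ^ n * Real.exp (-(n * δ))
      ≤ Real.exp (δ - δ ^ 2 / 4) ^ n * Real.exp (-(n * δ)) := by gcongr
    _ = _ := by rw [← Real.exp_nat_mul, ← Real.exp_add]; congr 1; ring

/-- Comparison of `n` uniform clauses with independent clauses of a suitable density. -/
lemma exists_drawProb_le (hn' : r ^ 3 ≤ 8 * n) (hr : 46 ≤ r) :
    ∃ q : ℝ, 0 ≤ q ∧ q ≤ 1 / 2 ∧ 2 * n * q ≤ 1 + 2 / r ∧ (clauseSet n).Nonempty ∧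
      ∀ A : Set (Finset (ℤ × ℤ)), IsUpperSet A →
        drawProb (clauseSet n) n A ≤ bernProb q (clauseSet n) A + Real.exp (-(r / 32)) := by
  have hR : (46 : ℝ) ≤ r := by exact_mod_cast hr
  have hR0 : (0 : ℝ) < r := by linarith
  have hN' : (r : ℝ) ^ 3 ≤ 8 * n := by exact_mod_cast hn'
  have hrn : (r : ℝ) + 2 ≤ n := by nlinarith [sq_nonneg (r : ℝ)]
  have hM : 4 * (n : ℝ) ^ 2 ≤ 2 * (clauseSet n).card + 4 * n := by
    exact_mod_cast le_card_clauseSet n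
  set M : ℝ := ((clauseSet n).card : ℝ) with hMdef
  have hM0 : 0 < M := by nlinarith
  set δ : ℝ := 1 / r with hδ
  have hδ0 : 0 < δ := by positivity
  have hδ1 : δ ≤ 1 := by rw [hδ, div_le_one hR0]; linarith
  set a : ℝ := n * (1 + δ) with ha
  have ha0 : 0 ≤ a := by positivity
  have hq1 : 1 - Real.exp (-(a / M)) ≤ a / M := by linarith [Real.add_one_le_exp (-(a / M))]
  have hq0 : 0 ≤ 1 - Real.exp (-(a / M)) := by
    have : 0 ≤ a / M := by positivity
    have := Real.exp_le_one_iff.2 (neg_nonpos.2 this)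
    linarith
  have hnq : 2 * n * (1 - Real.exp (-(a / M))) ≤ 1 + 2 / r := by
    calc 2 * n * (1 - Real.exp (-(a / M))) ≤ 2 * n * (a / M) := by gcongr
      _ = 2 * n ^ 2 * (1 + δ) / M := by rw [ha]; ring
      _ ≤ 1 + 2 / r := by
        rw [div_le_iff₀ hM0]
        have e : 2 / (r : ℝ) = 2 * δ := by rw [hδ]; ring
        have e1 : δ * r = 1 := by rw [hδ]; field_simp
        have e2 : (n : ℝ) * (1 + δ) ≤ (1 + 2 * δ) * (n - 1) := by nlinarith
        rw [e]
        have e3 : 2 * n * (n - 1) ≤ M := by nlinarith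
        calc 2 * (n : ℝ) ^ 2 * (1 + δ) = 2 * n * (n * (1 + δ)) := by ring
          _ ≤ 2 * n * ((1 + 2 * δ) * (n - 1)) := by gcongr
          _ = (1 + 2 * δ) * (2 * n * (n - 1)) := by ring
          _ ≤ _ := by gcongr
  have hne : (clauseSet n).Nonempty := Finset.card_pos.1 (Nat.cast_pos.1 hM0)
  refine ⟨1 - Real.exp (-(a / M)), hq0, ?_, hnq, hne, fun A hA => ?_⟩
  · have : 2 / (r : ℝ) ≤ 1 := by rw [div_le_one hR0]; linarith
    nlinarith
  · refine (drawProb_le_bernProb_add hne hA ha0 (θ := (1 + δ)⁻¹) (by positivity)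
      (inv_le_one_of_one_le₀ (by linarith)) n).trans ?_
    gcongr
    have e : a * (1 + δ)⁻¹ - a = -(n * δ) := by rw [ha]; field_simp; ring
    rw [e, inv_pow, inv_inv]
    refine (one_add_pow_mul_exp_le hδ0.le hδ1 n).trans (Real.exp_le_exp.2 (neg_le_neg ?_))
    rw [hδ]
    field_simp
    linarith

lemma probSatFixed_le_empty (hC : (clauseSet n).Nonempty) (L : Finset ℤ) :
    probSatFixed n m L ≤ probSatFixed n m ∅ := by
  rw [probSatFixed_eq n m L hC, probSatFixed_eq n m ∅ hC]
  have := drawProb_mono (C := clauseSet n) m fun S _ hS => unsatFixed_empty_subset L hS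
  linarith

lemma exp_sub_le_probSatFixed (hn : n ≤ r ^ 3) (hn' : r ^ 3 ≤ 8 * n) (hr : 46 ≤ r)
    (hr' : 288 * Real.exp 6 ≤ r) :
    Real.exp (-12288) * Real.exp (-(1728 * Real.exp 6)) - Real.exp (-(r / 32))
      ≤ probSatFixed n n ∅ := by
  obtain ⟨q, h0, h1, hq, hC, hA⟩ := exists_drawProb_le hn' hr
  have e1 := exp_le_one_sub_bernProb_unsat h0 h1 hn hn' hr hr' hq
  have e2 := hA _ (isUpperSet_unsatFixed ∅)
  rw [probSatFixed_eq n n ∅ hC]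
  linarith

lemma probSatFixed_empty_le_add (hn' : r ^ 3 ≤ 8 * n) (hr : 46 ≤ r) (hL : Consistent n L) :
    probSatFixed n n ∅ ≤ probSatFixed n n L +
      (96 * (L.card / r) + 64 * (L.card / r) ^ 2 + Real.exp (-(r / 32))) := by
  obtain ⟨q, h0, h1, hq, hC, hA⟩ := exists_drawProb_le hn' hr
  have e1 := bernProb_spreadEvent_le h0 h1 hn' (by omega) hq (clauseSet n) hL.1
  have e2 := hA _ (isUpperSet_spreadEvent n r L)
  have e3 : drawProb (clauseSet n) n (unsatFixed L)
      ≤ drawProb (clauseSet n) n (unsatFixed ∅ ∪ spreadEvent n r L) := by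
    refine drawProb_mono n fun S hS h => ?_
    by_cases h' : S ∈ unsatFixed ∅
    · exact Or.inl h'
    · exact Or.inr (mem_spreadEvent hS hL h h')
  have e4 := drawProb_union_le (C := clauseSet n) (A := unsatFixed ∅) (B := spreadEvent n r L) n
  rw [probSatFixed_eq n n ∅ hC, probSatFixed_eq n n L hC]
  linarith

end Transfer

section Limits

/-- The length scale `n ^ (1 / 3)`. -/
def cubeScale (n : ℕ) : ℕ := ⌈(n : ℝ) ^ (1 / 3 : ℝ)⌉₊

lemma rpow_third_pow (n : ℕ) : ((n : ℝ) ^ (1 / 3 : ℝ)) ^ 3 = n := by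
  rw [← Real.rpow_natCast, ← Real.rpow_mul (by positivity)]
  norm_num

lemma le_cubeScale_pow (n : ℕ) : n ≤ cubeScale n ^ 3 := by
  have h : (n : ℝ) ^ (1 / 3 : ℝ) ≤ cubeScale n := Nat.le_ceil _
  have h3 : ((n : ℝ) ^ (1 / 3 : ℝ)) ^ 3 ≤ (cubeScale n : ℝ) ^ 3 := by gcongr
  rw [rpow_third_pow] at h3
  exact_mod_cast h3

lemma cubeScale_pow_le {n : ℕ} (hn : 1 ≤ n) : cubeScale n ^ 3 ≤ 8 * n := by
  have hn' : (1 : ℝ) ≤ n := by exact_mod_cast hn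
  have h1 : (1 : ℝ) ≤ (n : ℝ) ^ (1 / 3 : ℝ) := Real.one_le_rpow hn' (by norm_num)
  have h : (cubeScale n : ℝ) ≤ 2 * (n : ℝ) ^ (1 / 3 : ℝ) := by
    have : (cubeScale n : ℝ) < _ := Nat.ceil_lt_add_one (by positivity)
    linarith
  have h3 : (cubeScale n : ℝ) ^ 3 ≤ (2 * (n : ℝ) ^ (1 / 3 : ℝ)) ^ 3 := by gcongr
  rw [mul_pow, rpow_third_pow] at h3
  norm_num at h3
  exact_mod_cast h3

lemma tendsto_cubeScale : Tendsto (fun n => (cubeScale n : ℝ)) atTop atTop := by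
  refine tendsto_atTop_mono (fun n => Nat.le_ceil _) ?_
  exact (tendsto_rpow_atTop (by norm_num)).comp tendsto_natCast_atTop_atTop

lemma tendsto_exp_cubeScale :
    Tendsto (fun n => Real.exp (-((cubeScale n : ℝ) / 32))) atTop (𝓝 0) :=
  Real.tendsto_exp_atBot.comp
    (tendsto_neg_atTop_atBot.comp (tendsto_cubeScale.atTop_div_const (by norm_num)))

lemma tendsto_div_cubeScale {ε C : ℝ} (hε : 0 < ε) {f : ℕ → ℕ}
    (hf : ∀ n, (f n : ℝ) ≤ C * (n : ℝ) ^ ((1 : ℝ) / 3 - ε)) :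
    Tendsto (fun n => (f n : ℝ) / cubeScale n) atTop (𝓝 0) := by
  have h : Tendsto (fun n : ℕ => C * (n : ℝ) ^ (-ε)) atTop (𝓝 0) := by
    simpa using ((tendsto_rpow_neg_atTop hε).comp tendsto_natCast_atTop_atTop).const_mul C
  refine squeeze_zero' (Eventually.of_forall fun n => by positivity) ?_ h
  filter_upwards [eventually_ge_atTop 1] with n hn
  have hn' : (0 : ℝ) < n := by exact_mod_cast hn
  have h1 : (0 : ℝ) < (n : ℝ) ^ (1 / 3 : ℝ) := by positivity
  have h2 : (n : ℝ) ^ (1 / 3 : ℝ) ≤ cubeScale n := Nat.le_ceil _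
  calc (f n : ℝ) / cubeScale n ≤ f n / (n : ℝ) ^ (1 / 3 : ℝ) := by gcongr
    _ ≤ C * (n : ℝ) ^ ((1 : ℝ) / 3 - ε) / (n : ℝ) ^ (1 / 3 : ℝ) := by gcongr; exact hf n
    _ = C * (n : ℝ) ^ (-ε) := by
      rw [sub_eq_add_neg, Real.rpow_add hn']
      field_simp

lemma probSatFixed_nonneg (n m : ℕ) (L : Finset ℤ) : 0 ≤ probSatFixed n m L := by
  unfold probSatFixed; positivity

lemma probSatFixed_le_one (n m : ℕ) (L : Finset ℤ) : probSatFixed n m L ≤ 1 := by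
  classical
  refine div_le_one_of_le₀ ?_ (by positivity)
  rw [← Nat.card_eq_fintype_card]
  exact_mod_cast Finite.card_subtype_le _

lemma liminf_eq_of_le_of_le_add {u v e : ℕ → ℝ} (hu : ∀ n, 0 ≤ u n) (hv : ∀ n, v n ≤ 1)
    (huv : ∀ᶠ n in atTop, u n ≤ v n) (hvu : ∀ᶠ n in atTop, v n ≤ u n + e n)
    (he : Tendsto e atTop (𝓝 0)) : liminf u atTop = liminf v atTop := by
  have hbu : IsBoundedUnder (· ≥ ·) atTop u := ⟨0, by simpa using ⟨0, fun n _ => hu n⟩⟩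
  have hbv : IsBoundedUnder (· ≥ ·) atTop v := by
    refine ⟨0, ?_⟩
    rw [eventually_map]
    filter_upwards [huv] with n h using (hu n).trans h
  have hcv : IsCoboundedUnder (· ≥ ·) atTop v :=
    IsBoundedUnder.isCoboundedUnder_ge ⟨1, by simpa using ⟨0, fun n _ => hv n⟩⟩
  have hcu : IsCoboundedUnder (· ≥ ·) atTop u := by
    refine IsBoundedUnder.isCoboundedUnder_ge ⟨1, ?_⟩
    rw [eventually_map]
    filter_upwards [huv] with n h using h.trans (hv n)
  refine le_antisymm (liminf_le_liminf huv hbu hcv) (le_of_forall_lt fun c hc => ?_)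
  obtain ⟨c', hcc', hc'⟩ := exists_between hc
  obtain ⟨c'', hcc'', hc''⟩ := exists_between hcc'
  refine lt_of_lt_of_le hcc'' (le_liminf_of_le hcu ?_)
  filter_upwards [eventually_lt_of_lt_liminf hc' hbv, hvu,
    he.eventually (gt_mem_nhds (show (0 : ℝ) < c' - c'' by linarith))] with n h1 h2 h3
  linarith

end Limits

/-- if `f(n) ≤ C n^{1/3−ε}`, then fixing any consistent family of literal sets of
size `f(n)` in `Φₙ ~ F₂(n,n)` does not change the liminf of the satisfiability probability,
and this common liminf is strictly positive. -/
theorem statement1 (ε : ℝ) (hε : 0 < ε) (hε' : ε < 1 / 3)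
    (C : ℝ) (hC : 0 < C)
    (f : ℕ → ℕ) (hf : ∀ n, (f n : ℝ) ≤ C * (n : ℝ) ^ ((1 : ℝ) / 3 - ε))
    (L : (n : ℕ) → Finset ℤ)
    (hLcons : ∀ n, Consistent n (L n)) (hLcard : ∀ n, (L n).card = f n) :
    liminf (fun n => probSatFixed n n (L n)) atTop
      = liminf (fun n => probSatFixed n n (∅ : Finset ℤ)) atTop ∧
    0 < liminf (fun n => probSatFixed n n (∅ : Finset ℤ)) atTop := by
  have hbig : ∀ᶠ n in atTop, 46 ≤ cubeScale n := by
    filter_upwards [tendsto_cubeScale.eventually_ge_atTop 46] with n hn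
    exact_mod_cast hn
  constructor
  · refine liminf_eq_of_le_of_le_add (fun n => probSatFixed_nonneg _ _ _)
      (fun n => probSatFixed_le_one _ _ _) (e := fun n => 96 * ((f n : ℝ) / cubeScale n) +
        64 * ((f n : ℝ) / cubeScale n) ^ 2 + Real.exp (-((cubeScale n : ℝ) / 32))) ?_ ?_ ?_
    · filter_upwards [hbig, eventually_ge_atTop 1] with n hr hn
      obtain ⟨-, -, -, -, hne, -⟩ := exists_drawProb_le (cubeScale_pow_le hn) hr
      exact probSatFixed_le_empty hne _
    · filter_upwards [hbig, eventually_ge_atTop 1] with n hr hn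
      rw [← hLcard n]
      exact probSatFixed_empty_le_add (cubeScale_pow_le hn) hr (hLcons n)
    · have h := tendsto_div_cubeScale hε hf
      simpa using ((h.const_mul 96).add ((h.pow 2).const_mul 64)).add tendsto_exp_cubeScale
  · set c : ℝ := Real.exp (-12288) * Real.exp (-(1728 * Real.exp 6)) with hc
    have hc0 : 0 < c := by positivity
    refine lt_of_lt_of_le (half_pos hc0) (le_liminf_of_le
      (IsBoundedUnder.isCoboundedUnder_ge
        ⟨1, by simpa using ⟨0, fun n _ => probSatFixed_le_one n n ∅⟩⟩) ?_)
    filter_upwards [hbig, eventually_ge_atTop 1,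
      tendsto_cubeScale.eventually_ge_atTop (288 * Real.exp 6),
      tendsto_exp_cubeScale.eventually (gt_mem_nhds (half_pos hc0))] with n hr hn hr' he
    have := exp_sub_le_probSatFixed (le_cubeScale_pow n) (cubeScale_pow_le hn) hr hr'
    rw [← hc] at this
    linarith
end
end

section
/- Consider the under-constrained counting chain with parameter q ∈ (0, 1/3). Then P(M₁^{(r)} ≤ n^q·log n for all r ∈ {1,…,R}) → 1 as n → ∞. -/
open Filter Topology MeasureTheory ENNReal

noncomputable section

/-- `p₀(a,b) = b(b−1)/(4a(a−1))`. -/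
def prob0 (a b : ℕ) : ℝ := ((b : ℝ) * ((b : ℝ) - 1)) / (4 * (a : ℝ) * ((a : ℝ) - 1))

/-- `p₁(a,b) = (a−b)b/(a(a−1))`. -/
def prob1 (a b : ℕ) : ℝ := (((a : ℝ) - (b : ℝ)) * (b : ℝ)) / ((a : ℝ) * ((a : ℝ) - 1))

/-- `p₂(a,b) = (a−b)(a−b−1)/(a(a−1))`. -/
def prob2 (a b : ℕ) : ℝ :=
  (((a : ℝ) - (b : ℝ)) * ((a : ℝ) - (b : ℝ) - 1)) / ((a : ℝ) * ((a : ℝ) - 1))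

/-- `p⋆(a,b) = 1 − p₀ − p₁ − p₂`. -/
def probStar (a b : ℕ) : ℝ := 1 - prob0 a b - prob1 a b - prob2 a b

/-- The probability vector `p(a,b) = (p₀,p₁,p₂,p⋆)(a,b)`. -/
def pvec (a b : ℕ) : Fin 4 → ℝ := ![prob0 a b, prob1 a b, prob2 a b, probStar a b]

/-- The multinomial pmf with `N` trials, four categories. -/
def multinomialPMF (N : ℕ) (p : Fin 4 → ℝ) (k : Fin 4 → ℕ) : ℝ :=
  if (∑ i, k i) = N then
    (N.factorial : ℝ) / (∏ i, ((k i).factorial : ℝ)) * ∏ i, (p i) ^ (k i)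
  else 0

/-- `R = ⌊n^{1−2q}/log³ n⌋`. -/
def RparU (n : ℕ) (q : ℝ) : ℕ := ⌊(n : ℝ) ^ (1 - 2 * q) / (Real.log n) ^ 3⌋₊

/-- `US a b h k = S^{(k−1)}`, where `S^{(−1)} = M₁^{(−1)} = a`, `S^{(0)} = a + b`
(`M₁^{(0)} = b`) and `S^{(r)} = S^{(r−1)} + M₁^{(r)}` with `M₁^{(r)} = h r` for `r ≥ 1`. -/
def US (a b : ℕ) (h : ℕ → ℕ) : ℕ → ℕ
  | 0 => a
  | k + 1 => US a b h k + (if k = 0 then b else h k)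

/-- `M₁^{(r−1)}` seen from round `r ≥ 1`. -/
def UM1prev (b : ℕ) (h : ℕ → ℕ) (r : ℕ) : ℕ := if r ≤ 1 then b else h (r - 1)

/-- The under-constrained counting chain: `A = M₁^{(−1)}`, `B = M₁^{(0)}`, and for rounds
`r ∈ {1,…,R}`, conditionally on all variables of rounds `< r`, the vector
`M ω r = (M₀,M₁,M₂,M⋆)^{(r)}` is Multinomial with `n − S^{(r−1)}` trials and probability
vector `p(n − S^{(r−2)}, M₁^{(r−1)})`. -/
def IsUnderChain (n : ℕ) (q : ℝ) {Ω : Type*} [MeasurableSpace Ω] (P : Measure Ω)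
    (A B : Ω → ℕ) (M : Ω → ℕ → Fin 4 → ℕ) : Prop :=
  Measurable A ∧ Measurable B ∧ (∀ r, Measurable (fun ω => M ω r)) ∧
  (∀ ω, A ω ≤ n) ∧ (∀ ω, B ω ≤ n) ∧
  ∀ r : ℕ, 1 ≤ r → r ≤ RparU n q → ∀ a b : ℕ, ∀ h : ℕ → Fin 4 → ℕ, ∀ v : Fin 4 → ℕ,
    P {ω | A ω = a ∧ B ω = b ∧ (∀ s, 1 ≤ s → s < r → M ω s = h s) ∧ M ω r = v}
      = ENNReal.ofReal
          (multinomialPMF (n - US a b (fun s => h s 1) r)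
            (pvec (n - US a b (fun s => h s 1) (r - 1))
              (UM1prev b (fun s => h s 1) r)) v)
        * P {ω | A ω = a ∧ B ω = b ∧ (∀ s, 1 ≤ s → s < r → M ω s = h s)}

lemma tsum_multinomialPMF_le_one (N : ℕ) (p : Fin 4 → ℝ) (hp : ∀ i, 0 ≤ p i)
    (hsum : ∑ i, p i = 1) :
    ∑' v, ENNReal.ofReal (multinomialPMF N p v) ≤ 1 := by
  rw [tsum_eq_sum (s := Finset.piAntidiag Finset.univ N)]
  · rw [← ENNReal.ofReal_sum_of_nonneg]
    · rw [← ENNReal.ofReal_one]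
      apply ENNReal.ofReal_le_ofReal
      rw [← one_pow N, ← hsum, Finset.sum_pow_eq_sum_piAntidiag]
      apply le_of_eq
      refine Finset.sum_congr rfl fun k hk => ?_
      have hk' : ∑ i, k i = N := (Finset.mem_piAntidiag.1 hk).1
      rw [multinomialPMF, if_pos hk', Nat.multinomial, hk',
        Nat.cast_div (hk' ▸ Nat.prod_factorial_dvd_factorial_sum _ _)]
      · push_cast; rfl
      · exact_mod_cast Finset.prod_ne_zero_iff.2 fun i _ => Nat.factorial_ne_zero _
    · intro v _
      unfold multinomialPMF
      split_ifs
      · exact mul_nonneg (by positivity) (Finset.prod_nonneg fun i _ => pow_nonneg (hp i) _)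
      · exact le_rfl
  · intro v hv
    have : ∑ i, v i ≠ N := fun h => hv (by simp [Finset.mem_piAntidiag, h])
    simp [multinomialPMF, this]

/-- Size-biasing in the second category removes one trial. -/
lemma succ_mul_multinomialPMF_succ (N : ℕ) (p : Fin 4 → ℝ) (w : Fin 4 → ℕ) :
    ((w 1 + 1 : ℕ) : ℝ) * multinomialPMF (N + 1) p (w + Pi.single 1 1)
      = (N + 1 : ℕ) * p 1 * multinomialPMF N p w := by
  have h1 : (∑ i, (w + Pi.single 1 1 : Fin 4 → ℕ) i = N + 1) ↔ ∑ i, w i = N := by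
    simp [Finset.sum_add_distrib]
  unfold multinomialPMF
  simp only [h1]
  split_ifs with h
  · simp only [Fin.prod_univ_four, Pi.add_apply, Pi.single_apply]
    simp only [Fin.isValue, Fin.reduceEq, if_true, if_false, add_zero, Nat.factorial_succ,
      pow_succ]
    have := Nat.factorial_pos
    have a0 : ((w 0).factorial : ℝ) ≠ 0 := by exact_mod_cast (this _).ne'
    have a1 : ((w 1).factorial : ℝ) ≠ 0 := by exact_mod_cast (this _).ne'
    have a2 : ((w 2).factorial : ℝ) ≠ 0 := by exact_mod_cast (this _).ne'
    have a3 : ((w 3).factorial : ℝ) ≠ 0 := by exact_mod_cast (this _).ne'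
    push_cast
    have a4 : (w 1 : ℝ) + 1 ≠ 0 := by positivity
    field_simp
  · simp

lemma tsum_mul_multinomialPMF_le (N : ℕ) (p : Fin 4 → ℝ) (hp : ∀ i, 0 ≤ p i)
    (hsum : ∑ i, p i = 1) :
    ∑' v : Fin 4 → ℕ, (v 1 : ℝ≥0∞) * ENNReal.ofReal (multinomialPMF (N + 1) p v)
      ≤ ENNReal.ofReal ((N + 1 : ℕ) * p 1) := by
  have hinj : Function.Injective (fun w : Fin 4 → ℕ => w + Pi.single 1 1) :=
    add_left_injective _
  rw [← hinj.tsum_eq]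
  · have : ∀ w : Fin 4 → ℕ, (((w + Pi.single 1 1 : Fin 4 → ℕ) 1 : ℕ) : ℝ≥0∞)
        * ENNReal.ofReal (multinomialPMF (N + 1) p (w + Pi.single 1 1))
        = ENNReal.ofReal ((N + 1 : ℕ) * p 1) * ENNReal.ofReal (multinomialPMF N p w) := by
      intro w
      rw [← ENNReal.ofReal_mul (mul_nonneg (Nat.cast_nonneg _) (hp 1)),
        ← succ_mul_multinomialPMF_succ, ENNReal.ofReal_mul (Nat.cast_nonneg _),
        ENNReal.ofReal_natCast]
      simp
    simp only [this]
    rw [ENNReal.tsum_mul_left]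
    exact mul_le_of_le_one_right' (tsum_multinomialPMF_le_one N p hp hsum)
  · intro v hv
    have h1 : v 1 ≠ 0 := by
      rintro h
      simp [h] at hv
    refine ⟨v - Pi.single 1 1, ?_⟩
    ext i
    by_cases hi : i = 1
    · subst hi; simp; omega
    · simp [hi]

lemma pvec_sum (a b : ℕ) : ∑ i, pvec a b i = 1 := by
  simp [Fin.sum_univ_four, pvec, probStar]

lemma pvec_nonneg {a b : ℕ} (h : b < a) (i : Fin 4) : 0 ≤ pvec a b i := by
  have ha : (1 : ℝ) ≤ a := by exact_mod_cast (by omega : 1 ≤ a)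
  have hab : (b : ℝ) + 1 ≤ a := by exact_mod_cast h
  have hb0 : (0 : ℝ) ≤ b := b.cast_nonneg
  have hb : (0 : ℝ) ≤ (b : ℝ) * ((b : ℝ) - 1) := by
    rcases Nat.eq_zero_or_pos b with rfl | hb
    · simp
    · have : (1 : ℝ) ≤ b := by exact_mod_cast hb
      exact mul_nonneg hb0 (by linarith)
  have hden : (0 : ℝ) ≤ (a : ℝ) * ((a : ℝ) - 1) := mul_nonneg (by linarith) (by linarith)
  have h0 : prob0 a b ≤ ((b : ℝ) * ((b : ℝ) - 1)) / ((a : ℝ) * ((a : ℝ) - 1)) := by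
    have : prob0 a b = ((b : ℝ) * ((b : ℝ) - 1)) / ((a : ℝ) * ((a : ℝ) - 1)) / 4 := by
      rw [prob0, div_div]; ring_nf
    rw [this]
    have := div_nonneg hb hden
    linarith
  have hstar : 0 ≤ probStar a b := by
    have : prob0 a b + prob1 a b + prob2 a b ≤ 1 := by
      refine (add_le_add_left (add_le_add_left h0 _) _).trans ?_
      rw [prob1, prob2, ← add_div, ← add_div]
      refine div_le_one_of_le₀ ?_ hden
      nlinarith [mul_nonneg hb0 (by linarith : (0 : ℝ) ≤ a - b)]
    unfold probStar
    linarith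
  fin_cases i
  · exact div_nonneg hb (by linarith)
  · exact div_nonneg (mul_nonneg (by linarith) hb0) hden
  · exact div_nonneg (mul_nonneg (by linarith) (by linarith)) hden
  · exact hstar

lemma sub_mul_prob1_le {a b : ℕ} (h : b < a) : ((a : ℝ) - b) * prob1 a b ≤ b := by
  have hab : (b : ℝ) + 1 ≤ a := by exact_mod_cast h
  rcases Nat.eq_zero_or_pos b with rfl | hb
  · simp [prob1]
  · have hb' : (1 : ℝ) ≤ b := by exact_mod_cast hb
    have hden : (0 : ℝ) < (a : ℝ) * ((a : ℝ) - 1) := mul_pos (by linarith) (by linarith)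
    rw [prob1, ← mul_div_assoc, div_le_iff₀ hden]
    have : ((a : ℝ) - b) * (a - b) ≤ a * (a - 1) :=
      mul_le_mul (by linarith) (by linarith) (by linarith) (by linarith)
    nlinarith

/-- The conditional mean of the second category does not exceed its previous value. -/
lemma tsum_mul_multinomialPMF_pvec_le (a b : ℕ) :
    ∑' v : Fin 4 → ℕ, (v 1 : ℝ≥0∞) * ENNReal.ofReal (multinomialPMF (a - b) (pvec a b) v)
      ≤ b := by
  by_cases h : b < a
  · obtain ⟨N, hN⟩ : ∃ N, a - b = N + 1 := ⟨a - b - 1, by omega⟩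
    rw [hN]
    refine (tsum_mul_multinomialPMF_le N _ (pvec_nonneg h) (pvec_sum a b)).trans ?_
    rw [← hN, ← ENNReal.ofReal_natCast, Nat.cast_sub h.le]
    exact ENNReal.ofReal_le_ofReal (sub_mul_prob1_le h)
  · have : a - b = 0 := by omega
    rw [this, ENNReal.tsum_eq_zero.2]
    · exact zero_le
    · intro v
      by_cases hv : ∑ i, v i = 0
      · have : v 1 = 0 := by
          simpa using (Finset.sum_eq_zero_iff.1 hv) 1 (Finset.mem_univ _)
        simp [this]
      · simp [multinomialPMF, hv]

lemma lintegral_eq_tsum_fiber {Ω ι : Type*} [MeasurableSpace Ω] (P : Measure Ω)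
    [Countable ι] [MeasurableSpace ι] [MeasurableSingletonClass ι] {H : Ω → ι}
    (hH : Measurable H) (F : Ω → ℝ≥0∞) :
    ∫⁻ ω, F ω ∂P = ∑' i, ∫⁻ ω in H ⁻¹' {i}, F ω ∂P := by
  rw [← lintegral_iUnion (fun i => hH (measurableSet_singleton i)),
    ← Set.preimage_iUnion, Set.iUnion_of_singleton, Set.preimage_univ, Measure.restrict_univ]
  intro i j hij
  exact Disjoint.preimage _ (by simpa using hij)

/-- One-step supermartingale inequality along events determined by the past. -/
lemma IsUnderChain.lintegral_step {n : ℕ} {q : ℝ} {Ω : Type*} [MeasurableSpace Ω]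
    {P : Measure Ω} {A B : Ω → ℕ} {M : Ω → ℕ → Fin 4 → ℕ}
    (hc : IsUnderChain n q P A B M) {r : ℕ} (hr : r + 1 ≤ RparU n q)
    (g : Ω → ℝ≥0∞)
    (hg : ∀ ω ω', (∀ s, 1 ≤ s → s ≤ r → M ω s = M ω' s) → g ω = g ω') :
    ∫⁻ ω, g ω * (M ω (r + 1) 1 : ℝ≥0∞) ∂P
      ≤ ∫⁻ ω, g ω * (UM1prev (B ω) (fun s => M ω s 1) (r + 1) : ℝ≥0∞) ∂P := by
  obtain ⟨hA, hB, hM, -, -, hstep⟩ := hc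
  let H : Ω → ℕ × ℕ × (Fin r → Fin 4 → ℕ) := fun ω => (A ω, B ω, fun i => M ω (i + 1))
  have hH : Measurable H :=
    hA.prodMk (hB.prodMk (measurable_pi_lambda _ fun i => hM _))
  rw [lintegral_eq_tsum_fiber P hH, lintegral_eq_tsum_fiber P hH]
  refine ENNReal.tsum_le_tsum fun i => ?_
  rcases (H ⁻¹' {i}).eq_empty_or_nonempty with he | ⟨ω₀, hω₀⟩
  · simp [he]
  have hfib : H ⁻¹' {i} = {ω | A ω = A ω₀ ∧ B ω = B ω₀ ∧
      ∀ s, 1 ≤ s → s < r + 1 → M ω s = M ω₀ s} := by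
    rw [← (hω₀ : H ω₀ = i)]
    ext ω
    simp only [Set.mem_preimage, Set.mem_singleton_iff, H, Prod.mk.injEq, Set.mem_ofPred_eq]
    refine and_congr_right fun _ => and_congr_right fun _ => ?_
    constructor
    · intro h s h1 h2
      have := congrFun h ⟨s - 1, by omega⟩
      simpa [Nat.sub_add_cancel h1] using this
    · intro h
      funext j
      exact h _ (by omega) (by omega)
  have hmeas : MeasurableSet (H ⁻¹' {i}) := hH (measurableSet_singleton i)
  have hgc : ∀ ω ∈ H ⁻¹' {i}, g ω = g ω₀ := by
    intro ω hω
    rw [hfib] at hω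
    exact hg _ _ fun s h1 h2 => hω.2.2 s h1 (by omega)
  have hfc : ∀ ω ∈ H ⁻¹' {i}, UM1prev (B ω) (fun s => M ω s 1) (r + 1)
      = UM1prev (B ω₀) (fun s => M ω₀ s 1) (r + 1) := by
    intro ω hω
    rw [hfib] at hω
    unfold UM1prev
    split_ifs with h
    · exact hω.2.1
    · show M ω (r + 1 - 1) 1 = M ω₀ (r + 1 - 1) 1
      rw [hω.2.2 _ (by omega) (by omega)]
  rw [setLIntegral_congr_fun (g := fun ω => g ω₀ * (M ω (r + 1) 1 : ℝ≥0∞)) hmeas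
      (fun ω hω => by simp only [hgc ω hω]),
    setLIntegral_congr_fun
      (f := fun ω => g ω * (UM1prev (B ω) (fun s => M ω s 1) (r + 1) : ℝ≥0∞))
      (g := fun _ => g ω₀ * (UM1prev (B ω₀) (fun s => M ω₀ s 1) (r + 1) : ℝ≥0∞)) hmeas
      (fun ω hω => by simp only [hgc ω hω, hfc ω hω])]
  have hm1 : Measurable fun ω => (M ω (r + 1) 1 : ℝ≥0∞) :=
    (Measurable.of_discrete (f := fun v : Fin 4 → ℕ => (v 1 : ℝ≥0∞))).comp (hM (r + 1))
  rw [lintegral_const_mul _ hm1, setLIntegral_const, mul_assoc]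
  gcongr
  rw [lintegral_eq_tsum_fiber _ (hM (r + 1))]
  have hv : ∀ v : Fin 4 → ℕ, ∫⁻ ω in (fun ω => M ω (r + 1)) ⁻¹' {v},
      (M ω (r + 1) 1 : ℝ≥0∞) ∂(P.restrict (H ⁻¹' {i}))
      = (v 1 : ℝ≥0∞) * ENNReal.ofReal (multinomialPMF
          (n - US (A ω₀) (B ω₀) (fun s => M ω₀ s 1) (r + 1))
          (pvec (n - US (A ω₀) (B ω₀) (fun s => M ω₀ s 1) r)
            (UM1prev (B ω₀) (fun s => M ω₀ s 1) (r + 1))) v) * P (H ⁻¹' {i}) := by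
    intro v
    have hmv : MeasurableSet ((fun ω => M ω (r + 1)) ⁻¹' {v}) :=
      hM (r + 1) (measurableSet_singleton v)
    rw [setLIntegral_congr_fun (g := fun _ => (v 1 : ℝ≥0∞)) hmv
      (fun ω hω => by
        have : M ω (r + 1) = v := hω
        simp only [this]), setLIntegral_const, Measure.restrict_apply hmv, mul_assoc]
    have := hstep (r + 1) (by omega) hr (A ω₀) (B ω₀) (M ω₀) v
    rw [hfib]
    rw [Nat.add_sub_cancel] at this
    rw [← this]
    congr 2
    ext ω
    simp only [Set.mem_inter_iff, Set.mem_preimage, Set.mem_singleton_iff, Set.mem_ofPred_eq]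
    tauto
  simp only [hv]
  rw [ENNReal.tsum_mul_right]
  gcongr
  have hUS : n - US (A ω₀) (B ω₀) (fun s => M ω₀ s 1) (r + 1)
      = (n - US (A ω₀) (B ω₀) (fun s => M ω₀ s 1) r)
        - UM1prev (B ω₀) (fun s => M ω₀ s 1) (r + 1) := by
    rw [Nat.sub_sub]
    congr 1
    simp only [US, UM1prev, Nat.add_sub_cancel]
    congr 1
    rcases Nat.eq_zero_or_pos r with rfl | h
    · simp
    · rw [if_neg (by omega), if_neg (by omega)]
  rw [hUS]
  exact tsum_mul_multinomialPMF_pvec_le _ _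

/-- The rounds `1, …, r` all have second category at most `T`. -/
def boundedUpTo {Ω : Type*} (M : Ω → ℕ → Fin 4 → ℕ) (T : ℝ) (r : ℕ) : Set Ω :=
  {ω | ∀ s, 1 ≤ s → s ≤ r → (M ω s 1 : ℝ) ≤ T}

lemma measurableSet_boundedUpTo {Ω : Type*} [MeasurableSpace Ω] {M : Ω → ℕ → Fin 4 → ℕ}
    (hM : ∀ r, Measurable fun ω => M ω r) (T : ℝ) (r : ℕ) :
    MeasurableSet (boundedUpTo M T r) := by
  have : boundedUpTo M T r = ⋂ s, ⋂ (_ : 1 ≤ s), ⋂ (_ : s ≤ r),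
      (fun ω => M ω s) ⁻¹' {v | (v 1 : ℝ) ≤ T} := by
    ext ω; simp [boundedUpTo]
  rw [this]
  exact .iInter fun s => .iInter fun _ => .iInter fun _ =>
    hM s (MeasurableSet.of_discrete)

/-- Maximal inequality for the under-constrained counting chain. -/
lemma IsUnderChain.maximal {n : ℕ} {q : ℝ} {Ω : Type*} [MeasurableSpace Ω]
    {P : Measure Ω} {A B : Ω → ℕ} {M : Ω → ℕ → Fin 4 → ℕ}
    (hc : IsUnderChain n q P A B M) (T : ℝ) (r : ℕ) (hr : r ≤ RparU n q) :
    ENNReal.ofReal T * P (boundedUpTo M T r)ᶜ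
      + ∫⁻ ω, (boundedUpTo M T r).indicator 1 ω
          * (UM1prev (B ω) (fun s => M ω s 1) (r + 1) : ℝ≥0∞) ∂P
      ≤ ∫⁻ ω, (B ω : ℝ≥0∞) ∂P := by
  induction r with
  | zero =>
    have : boundedUpTo M T 0 = Set.univ := by
      ext ω
      simp only [boundedUpTo, Set.mem_ofPred_eq, Set.mem_univ, iff_true]
      intro s h1 h2
      omega
    simp [this, UM1prev]
  | succ r ih =>
    refine le_trans ?_ (ih (by omega))
    have hM := hc.2.2.1
    have hG := measurableSet_boundedUpTo hM T r
    have hG' := measurableSet_boundedUpTo hM T (r + 1)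
    have hstep := hc.lintegral_step hr ((boundedUpTo M T r).indicator 1) (by
      intro ω ω' h
      have : ω ∈ boundedUpTo M T r ↔ ω' ∈ boundedUpTo M T r := by
        simp only [boundedUpTo, Set.mem_ofPred_eq]
        refine forall_congr' fun s => forall_congr' fun h1 => forall_congr' fun h2 => ?_
        rw [h s h1 h2]
      by_cases h' : ω ∈ boundedUpTo M T r
      · simp [h', this.1 h']
      · simp [h', mt this.2 h'])
    refine le_trans ?_ (add_le_add_right hstep _)
    have hm1 : Measurable fun ω => (M ω (r + 1) 1 : ℝ≥0∞) :=
      (Measurable.of_discrete (f := fun v : Fin 4 → ℕ => (v 1 : ℝ≥0∞))).comp (hM (r + 1))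
    have hi : ∀ S : Set Ω, MeasurableSet S → ENNReal.ofReal T * P S
        = ∫⁻ ω, S.indicator (fun _ => ENNReal.ofReal T) ω ∂P := fun S hS => by
      rw [lintegral_indicator_const hS]
    rw [hi _ hG.compl, hi _ hG'.compl, ← lintegral_add_left (measurable_const.indicator hG'.compl),
      ← lintegral_add_left (measurable_const.indicator hG.compl)]
    refine lintegral_mono fun ω => ?_
    have hsucc : ω ∈ boundedUpTo M T (r + 1) ↔
        ω ∈ boundedUpTo M T r ∧ (M ω (r + 1) 1 : ℝ) ≤ T := by
      simp only [boundedUpTo, Set.mem_ofPred_eq]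
      constructor
      · exact fun h => ⟨fun s h1 h2 => h s h1 (by omega), h _ (by omega) le_rfl⟩
      · rintro ⟨h, h'⟩ s h1 h2
        rcases Nat.lt_or_ge s (r + 1) with h3 | h3
        · exact h s h1 (by omega)
        · obtain rfl : s = r + 1 := by omega
          exact h'
    by_cases h : ω ∈ boundedUpTo M T r
    · by_cases h' : (M ω (r + 1) 1 : ℝ) ≤ T
      · have h2 := hsucc.2 ⟨h, h'⟩
        simp [h, h2, UM1prev]
      · have h2 : ω ∉ boundedUpTo M T (r + 1) := fun h3 => h' (hsucc.1 h3).2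
        simp only [Set.indicator, Set.mem_compl_iff, h, h2, not_true, not_false_iff, if_true,
          if_false, zero_mul, add_zero, zero_add, Pi.one_apply, one_mul]
        rw [← ENNReal.ofReal_natCast]
        exact ENNReal.ofReal_le_ofReal (not_le.1 h').le
    · have h2 : ω ∉ boundedUpTo M T (r + 1) := fun h3 => h (hsucc.1 h3).1
      simp [h, h2]

/-- for the under-constrained counting chain with `q ∈ (0, 1/3)`,
`P(M₁^{(r)} ≤ n^q log n for all r ∈ [1,R]) → 1`. -/
theorem statement16 (q : ℝ) (hq0 : 0 < q) (hq : q < 1 / 3)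
    (C₀ : ℝ) (hC₀ : 0 < C₀)
    (Ω : ℕ → Type*) [∀ n, MeasurableSpace (Ω n)]
    (P : ∀ n, Measure (Ω n)) [∀ n, IsProbabilityMeasure (P n)]
    (A B : ∀ n, Ω n → ℕ) (M : ∀ n, Ω n → ℕ → Fin 4 → ℕ)
    (hchain : ∀ n, 2 ≤ n → IsUnderChain n q (P n) (A n) (B n) (M n))
    (hEB : ∀ n, (∑' v : ℕ, (v : ℝ≥0∞) * (P n) {ω | B n ω = v})
      ≤ ENNReal.ofReal (C₀ * (n : ℝ) ^ q))
    (hAt : Tendsto (fun n => ((P n) {ω | (A n ω : ℝ) ≤ (n : ℝ) ^ q * Real.log n}).toReal)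
      atTop (𝓝 1))
    (hBt : Tendsto (fun n => ((P n) {ω | (B n ω : ℝ) ≤ (n : ℝ) ^ q * Real.log n}).toReal)
      atTop (𝓝 1)) :
    Tendsto
      (fun n => ((P n) {ω | ∀ r, 1 ≤ r → r ≤ RparU n q →
          (M n ω r 1 : ℝ) ≤ (n : ℝ) ^ q * Real.log n}).toReal)
      atTop (𝓝 1) := by
  have hlim : Tendsto (fun n : ℕ => 1 - C₀ / Real.log n) atTop (𝓝 1) := by
    simpa using tendsto_const_nhds.sub
      ((tendsto_const_nhds (x := C₀)).div_atTop
        (Real.tendsto_log_atTop.comp tendsto_natCast_atTop_atTop))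
  refine tendsto_of_tendsto_of_tendsto_of_le_of_le' hlim tendsto_const_nhds ?_
    (Eventually.of_forall fun n => measureReal_le_one)
  filter_upwards [eventually_ge_atTop 2] with n hn
  have hc := hchain n hn
  have hn' : (1 : ℝ) < n := by exact_mod_cast hn
  have hlog : 0 < Real.log n := Real.log_pos hn'
  have hpow : 0 < (n : ℝ) ^ q := Real.rpow_pos_of_pos (by linarith) q
  set T : ℝ := (n : ℝ) ^ q * Real.log n with hT
  have hTpos : 0 < T := mul_pos hpow hlog
  have hG := measurableSet_boundedUpTo hc.2.2.1 T (RparU n q)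
  have hB : ∫⁻ ω, (B n ω : ℝ≥0∞) ∂(P n) ≤ ENNReal.ofReal (C₀ * (n : ℝ) ^ q) := by
    refine le_of_eq_of_le ?_ (hEB n)
    rw [lintegral_eq_tsum_fiber _ hc.2.1]
    refine tsum_congr fun v => ?_
    have hmv : MeasurableSet (B n ⁻¹' {v}) := hc.2.1 (measurableSet_singleton v)
    rw [setLIntegral_congr_fun (g := fun _ => (v : ℝ≥0∞)) hmv
      (fun ω hω => by
        have : B n ω = v := hω
        simp only [this]), setLIntegral_const]
    rfl
  have hbad := ((le_self_add.trans (hc.maximal T _ le_rfl)).trans hB)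
  have hbad' : T * (P n).real (boundedUpTo (M n) T (RparU n q))ᶜ ≤ C₀ * (n : ℝ) ^ q := by
    have := ENNReal.toReal_mono ENNReal.ofReal_ne_top hbad
    rwa [ENNReal.toReal_mul, ENNReal.toReal_ofReal hTpos.le,
      ENNReal.toReal_ofReal (mul_pos hC₀ hpow).le] at this
  have hbound : (P n).real (boundedUpTo (M n) T (RparU n q))ᶜ ≤ C₀ / Real.log n := by
    rw [le_div_iff₀ hlog]
    refine le_of_mul_le_mul_left ?_ hpow
    calc _ = T * (P n).real (boundedUpTo (M n) T (RparU n q))ᶜ := by rw [hT]; ring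
      _ ≤ _ := hbad'.trans_eq (mul_comm _ _)
  rw [probReal_compl_eq_one_sub hG] at hbound
  change _ ≤ (P n).real (boundedUpTo (M n) T (RparU n q))
  linarith
end
end
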